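/- arXiv:2008.08503 — 3 statements merged into one kernel-verified Lean document; each statement's English description precedes it below -/
import Mathlib

section
/- For every integer k ≥ 3, the maximum size of a family of perfect matchings of K_{2k} any two of which have at least 2 edges in common equals (2k−5)!!; that is, every such 2-intersecting family has at most (2k−5)!! members, and there exists a 2-intersecting family with exactly (2k−5)!! members. -/
/-- A perfect matching of the complete graph on `Fin n`: a finite set of non-loop edges such
that every vertex lies on exactly one of them. -/
def IsPM {n : ℕ} (P : Finset (Sym2 (Fin n))) : Prop :=
  (∀ e ∈ P, ¬ e.IsDiag) ∧ ∀ v : Fin n, ∃! e, e ∈ P ∧ v ∈ e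

instance {n : ℕ} : DecidablePred (IsPM (n := n)) := fun _ => by
  unfold IsPM ExistsUnique; infer_instance

/-- The type of perfect matchings of the complete graph `K_n` on `Fin n`. -/
abbrev PM (n : ℕ) := {P : Finset (Sym2 (Fin n)) // IsPM P}

section

open Finset

/-- A (partial) matching: a finite set of non-loop, pairwise vertex-disjoint edges. -/
def IsMatching {n : ℕ} (P : Finset (Sym2 (Fin n))) : Prop :=
  (∀ e ∈ P, ¬ e.IsDiag) ∧ ∀ e ∈ P, ∀ f ∈ P, ∀ v, v ∈ e → v ∈ f → e = f

/-- The number of perfect matchings of the complete graph on `2 * m` vertices. -/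
def numPM : ℕ → ℕ
  | 0 => 1
  | m + 1 => (2 * m + 1) * numPM m

theorem numPM_pos (m : ℕ) : 0 < numPM m := by
  induction m with
  | zero => simp [numPM]
  | succ m ih => simp only [numPM]; positivity

theorem numPM_succ (m : ℕ) : numPM (m + 1) = Nat.doubleFactorial (2 * m + 1) := by
  induction m with
  | zero => simp [numPM]
  | succ m ih =>
    rw [numPM, ih, show 2 * (m + 1) + 1 = (2 * m + 1) + 2 by ring, Nat.doubleFactorial_add_two]

theorem le_numPM (m : ℕ) : m ≤ numPM m := by
  cases m with
  | zero => simp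
  | succ m =>
    have := numPM_pos m
    simp only [numPM]
    nlinarith

theorem IsMatching.mono {n : ℕ} {P Q : Finset (Sym2 (Fin n))} (hQ : IsMatching Q) (h : P ⊆ Q) :
    IsMatching P :=
  ⟨fun e he => hQ.1 e (h he), fun e he f hf => hQ.2 e (h he) f (h hf)⟩

theorem IsPM.isMatching {n : ℕ} {M : Finset (Sym2 (Fin n))} (hM : IsPM M) : IsMatching M :=
  ⟨hM.1, fun _ he _ hf v hve hvf => (hM.2 v).unique ⟨he, hve⟩ ⟨hf, hvf⟩⟩

theorem IsMatching.card_biUnion_toFinset {n : ℕ} {P : Finset (Sym2 (Fin n))}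
    (hP : IsMatching P) : (P.biUnion Sym2.toFinset).card = 2 * P.card := by
  rw [card_biUnion]
  · rw [sum_congr rfl fun e he => Sym2.card_toFinset_of_not_isDiag e (hP.1 e he)]
    simp [mul_comm]
  · intro e he f hf hef
    refine disjoint_left.2 fun v hv hv' => hef ?_
    exact hP.2 e he f hf v (Sym2.mem_toFinset.1 hv) (Sym2.mem_toFinset.1 hv')

theorem IsMatching.two_mul_card_le {n : ℕ} {P : Finset (Sym2 (Fin n))} (hP : IsMatching P) :
    2 * P.card ≤ n := by
  rw [← hP.card_biUnion_toFinset]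
  simpa using card_le_univ (P.biUnion Sym2.toFinset)

theorem IsPM.two_mul_card {n : ℕ} {M : Finset (Sym2 (Fin n))} (hM : IsPM M) :
    2 * M.card = n := by
  have h : M.biUnion Sym2.toFinset = univ := by
    refine eq_univ_of_forall fun v => ?_
    obtain ⟨e, ⟨he, hv⟩, -⟩ := hM.2 v
    exact mem_biUnion.2 ⟨e, he, Sym2.mem_toFinset.2 hv⟩
  rw [← hM.isMatching.card_biUnion_toFinset, h, card_univ, Fintype.card_fin]

theorem IsMatching.isPM {n : ℕ} {P : Finset (Sym2 (Fin n))} (hP : IsMatching P)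
    (h : 2 * P.card = n) : IsPM P := by
  refine ⟨hP.1, fun v => ?_⟩
  have hv : v ∈ P.biUnion Sym2.toFinset := by
    rw [eq_univ_of_card (P.biUnion Sym2.toFinset)
      (by rw [hP.card_biUnion_toFinset, h, Fintype.card_fin])]
    exact mem_univ v
  obtain ⟨e, he, hve⟩ := mem_biUnion.1 hv
  rw [Sym2.mem_toFinset] at hve
  exact ⟨e, ⟨he, hve⟩, fun f hf => hP.2 f hf.1 e he v hf.2 hve⟩

theorem IsMatching.insert {n : ℕ} {P : Finset (Sym2 (Fin n))} (hP : IsMatching P)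
    {e : Sym2 (Fin n)} (he : ¬ e.IsDiag) (h : ∀ f ∈ P, ∀ v, v ∈ e → v ∉ f) :
    IsMatching (insert e P) := by
  refine ⟨fun f hf => ?_, fun f hf g hg v hvf hvg => ?_⟩
  · rcases mem_insert.1 hf with rfl | hf
    · exact he
    · exact hP.1 f hf
  · rcases mem_insert.1 hf with rfl | hf <;> rcases mem_insert.1 hg with rfl | hg
    · rfl
    · exact (h g hg v hvf hvg).elim
    · exact (h f ‹_› v hvg hvf).elim
    · exact hP.2 f hf g hg v hvf hvg

/-- The members of a family of perfect matchings that contain a given set of edges. -/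
def starAt {n : ℕ} (F : Finset (PM n)) (P : Finset (Sym2 (Fin n))) : Finset (PM n) :=
  F.filter fun M => P ⊆ M.1

theorem mem_starAt {n : ℕ} {F : Finset (PM n)} {P : Finset (Sym2 (Fin n))} {M : PM n} :
    M ∈ starAt F P ↔ M ∈ F ∧ P ⊆ M.1 := by
  simp [starAt]

theorem card_starAt_univ {k : ℕ} (m : ℕ) (P : Finset (Sym2 (Fin (2 * k)))) (hP : IsMatching P)
    (hm : P.card + m = k) : (starAt univ P).card = numPM m := by
  induction m generalizing P with
  | zero =>
    have hpm : IsPM P := hP.isPM (by omega)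
    rw [numPM, card_eq_one]
    refine ⟨⟨P, hpm⟩, ?_⟩
    ext M
    simp only [mem_starAt, mem_univ, true_and, mem_singleton]
    constructor
    · intro h
      refine Subtype.ext (eq_of_subset_of_card_le h ?_).symm
      have := M.2.two_mul_card
      omega
    · rintro rfl
      exact Subset.refl _
  | succ m ih =>
    set U := univ \ P.biUnion Sym2.toFinset with hU
    have hUc : U.card = 2 * m + 2 := by
      rw [hU, card_sdiff_of_subset (subset_univ _), hP.card_biUnion_toFinset, card_univ,
        Fintype.card_fin]
      omega
    have hmemU : ∀ w, w ∈ U ↔ ∀ f ∈ P, w ∉ f := by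
      intro w
      simp [hU]
    obtain ⟨v, hv⟩ : U.Nonempty := card_pos.1 (by omega)
    have hins : ∀ w ∈ U.erase v, IsMatching (insert s(v, w) P) ∧
        (insert s(v, w) P).card = P.card + 1 := by
      intro w hw
      obtain ⟨hwv, hwU⟩ := mem_erase.1 hw
      constructor
      · refine hP.insert (by simpa using hwv.symm) fun f hf x hx => ?_
        rcases Sym2.mem_iff.1 hx with rfl | rfl
        · exact (hmemU _).1 hv f hf
        · exact (hmemU _).1 hwU f hf
      · refine card_insert_of_notMem fun h => ?_
        exact (hmemU v).1 hv _ h (Sym2.mem_mk_left v w)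
    have hun : starAt univ P = (U.erase v).biUnion fun w => starAt univ (insert s(v, w) P) := by
      ext M
      simp only [mem_starAt, mem_univ, true_and, mem_biUnion, insert_subset_iff]
      constructor
      · intro h
        obtain ⟨e, ⟨he, hve⟩, -⟩ := M.2.2 v
        obtain ⟨w, rfl⟩ := hve
        have hvw : w ≠ v := fun h' => M.2.1 _ he (by simp [h'])
        refine ⟨w, mem_erase.2 ⟨hvw, (hmemU w).2 fun f hf hwf => ?_⟩, he, h⟩
        have := M.2.isMatching.2 _ he f (h hf) w (Sym2.mem_mk_right v w) hwf
        subst this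
        exact (hmemU v).1 hv _ hf (Sym2.mem_mk_left v w)
      · rintro ⟨w, -, -, h⟩
        exact h
    rw [hun, card_biUnion, sum_congr rfl fun w hw => ih _ (hins w hw).1
      (by rw [(hins w hw).2]; omega), sum_const, card_erase_of_mem hv, hUc, numPM]
    · simp
    · intro w _ w' _ hww'
      refine disjoint_left.2 fun M hM hM' => hww' ?_
      have h1 := (mem_starAt.1 hM).2 (mem_insert_self _ _)
      have h2 := (mem_starAt.1 hM').2 (mem_insert_self _ _)
      have := M.2.isMatching.2 _ h1 _ h2 v (Sym2.mem_mk_left v w) (Sym2.mem_mk_left v w')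
      exact Sym2.congr_right.1 this

theorem starAt_subset_starAt_univ {n : ℕ} (F : Finset (PM n)) (P : Finset (Sym2 (Fin n))) :
    starAt F P ⊆ starAt univ P :=
  fun _ hM => mem_starAt.2 ⟨mem_univ _, (mem_starAt.1 hM).2⟩

theorem IsMatching.card_le {k : ℕ} {P : Finset (Sym2 (Fin (2 * k)))} (hP : IsMatching P) :
    P.card ≤ k := by
  have := hP.two_mul_card_le
  omega

theorem isMatching_of_mem_starAt {n : ℕ} {F : Finset (PM n)} {P : Finset (Sym2 (Fin n))} {M : PM n}
    (h : M ∈ starAt F P) : IsMatching P :=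
  M.2.isMatching.mono (mem_starAt.1 h).2

theorem card_starAt_le {k : ℕ} (F : Finset (PM (2 * k))) (P : Finset (Sym2 (Fin (2 * k)))) :
    (starAt F P).card ≤ numPM (k - P.card) := by
  rcases (starAt F P).eq_empty_or_nonempty with h | ⟨M, hM⟩
  · simp [h]
  · have hP := isMatching_of_mem_starAt hM
    rw [← card_starAt_univ (k - P.card) P hP (by have := hP.card_le; omega)]
    exact card_le_card (starAt_subset_starAt_univ F P)

/-- The edges of `N` that are vertex-disjoint from all edges of `P`. -/
def disjointEdges {n : ℕ} (N P : Finset (Sym2 (Fin n))) : Finset (Sym2 (Fin n)) :=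
  N.filter fun e => ∀ f ∈ P, ∀ v, v ∈ e → v ∉ f

theorem mem_disjointEdges {n : ℕ} {N P : Finset (Sym2 (Fin n))} {e : Sym2 (Fin n)} :
    e ∈ disjointEdges N P ↔ e ∈ N ∧ ∀ f ∈ P, ∀ v, v ∈ e → v ∉ f := by
  simp [disjointEdges]

theorem notMem_of_mem_disjointEdges {n : ℕ} {N P : Finset (Sym2 (Fin n))} {e : Sym2 (Fin n)}
    (h : e ∈ disjointEdges N P) : e ∉ P :=
  fun he => (mem_disjointEdges.1 h).2 e he _ e.out_fst_mem e.out_fst_mem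

theorem IsMatching.mem_disjointEdges {n : ℕ} {M N P : Finset (Sym2 (Fin n))} {e : Sym2 (Fin n)}
    (hM : IsMatching M) (hP : P ⊆ M) (heM : e ∈ M) (heN : e ∈ N) (heP : e ∉ P) :
    e ∈ disjointEdges N P :=
  _root_.mem_disjointEdges.2 ⟨heN, fun f hf v hve hvf =>
    heP (hM.2 e heM f (hP hf) v hve hvf ▸ hf)⟩

theorem IsMatching.disjointEdges_union {n : ℕ} {N P : Finset (Sym2 (Fin n))}
    (hN : IsMatching N) (hP : IsMatching P) : IsMatching (disjointEdges N P ∪ P) := by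
  refine ⟨fun e he => ?_, fun e he f hf v hve hvf => ?_⟩
  · rcases mem_union.1 he with he | he
    · exact hN.1 e (_root_.mem_disjointEdges.1 he).1
    · exact hP.1 e he
  · rcases mem_union.1 he with he | he <;> rcases mem_union.1 hf with hf | hf
    · exact hN.2 e (_root_.mem_disjointEdges.1 he).1 f (_root_.mem_disjointEdges.1 hf).1 v hve hvf
    · exact ((_root_.mem_disjointEdges.1 he).2 f hf v hve hvf).elim
    · exact ((_root_.mem_disjointEdges.1 hf).2 e he v hvf hve).elim
    · exact hP.2 e he f hf v hve hvf

theorem card_disjointEdges_union {n : ℕ} (N P : Finset (Sym2 (Fin n))) :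
    (disjointEdges N P ∪ P).card = (disjointEdges N P).card + P.card :=
  card_union_of_disjoint (disjoint_left.2 fun _ h => notMem_of_mem_disjointEdges h)

theorem IsMatching.card_disjointEdges_le {k : ℕ} {N P : Finset (Sym2 (Fin (2 * k)))}
    (hN : IsMatching N) (hP : IsMatching P) : (disjointEdges N P).card ≤ k - P.card := by
  have h := (hN.disjointEdges_union hP).card_le
  rw [card_disjointEdges_union] at h
  omega

theorem starAt_subset_biUnion {n : ℕ} {F : Finset (PM n)} {P N : Finset (Sym2 (Fin n))}
    (hN : ∀ M ∈ F, 2 ≤ (M.1 ∩ N).card) (hPN : (P ∩ N).card ≤ 1) :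
    starAt F P ⊆ (disjointEdges N P).biUnion fun e => starAt F (insert e P) := by
  intro M hM
  obtain ⟨hMF, hPM⟩ := mem_starAt.1 hM
  obtain ⟨e, he, he'⟩ := exists_mem_notMem_of_card_lt_card
    (show (P ∩ N).card < (M.1 ∩ N).card from by have := hN M hMF; omega)
  obtain ⟨heM, heN⟩ := mem_inter.1 he
  have heP : e ∉ P := fun h => he' (mem_inter.2 ⟨h, heN⟩)
  exact mem_biUnion.2 ⟨e, M.2.isMatching.mem_disjointEdges hPM heM heN heP,
    mem_starAt.2 ⟨hMF, insert_subset heM hPM⟩⟩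

theorem card_starAt_le_card_mul {n : ℕ} {F : Finset (PM n)} {P N : Finset (Sym2 (Fin n))}
    (hN : ∀ M ∈ F, 2 ≤ (M.1 ∩ N).card) (hPN : (P ∩ N).card ≤ 1) {u : ℕ}
    (hu : ∀ P', P'.card = P.card + 1 → (starAt F P').card ≤ u) :
    (starAt F P).card ≤ (disjointEdges N P).card * u :=
  (card_le_card (starAt_subset_biUnion hN hPN)).trans <| card_biUnion_le_card_mul _ _ _ fun _ he =>
    hu _ (card_insert_of_notMem (notMem_of_mem_disjointEdges he))

theorem card_starAt_le_sub_mul {k : ℕ} {F : Finset (PM (2 * k))}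
    (hF : ∀ M ∈ F, ∀ N ∈ F, 2 ≤ (M.1 ∩ N.1).card) {P : Finset (Sym2 (Fin (2 * k)))}
    (hP : IsMatching P → ∃ N ∈ F, (P ∩ N.1).card ≤ 1) {u : ℕ}
    (hu : ∀ P', P'.card = P.card + 1 → (starAt F P').card ≤ u) :
    (starAt F P).card ≤ (k - P.card) * u := by
  rcases (starAt F P).eq_empty_or_nonempty with h | ⟨M, hM⟩
  · simp [h]
  · have hPm := isMatching_of_mem_starAt hM
    obtain ⟨N, hN, hPN⟩ := hP hPm
    exact (card_starAt_le_card_mul (fun M hM => hF M hM N hN) hPN hu).trans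
      (Nat.mul_le_mul_right _ (N.2.isMatching.card_disjointEdges_le hPm))

/-- If `P` does not meet every member of `F` twice, then the members of `F` through `P` all share
an edge outside `P` with one fixed perfect matching; count the union of the resulting stars, in
which the completion of `P` by that matching is common to all. -/
theorem card_starAt_le_sub_mul_pred_add_one {k : ℕ} {F : Finset (PM (2 * k))}
    (hF : ∀ M ∈ F, ∀ N ∈ F, 2 ≤ (M.1 ∩ N.1).card) {P : Finset (Sym2 (Fin (2 * k)))}
    (hP : IsMatching P → ∃ N ∈ F, (P ∩ N.1).card ≤ 1) :
    (starAt F P).card ≤ (k - P.card) * (numPM (k - P.card - 1) - 1) + 1 := by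
  rcases (starAt F P).eq_empty_or_nonempty with h | ⟨M, hM⟩
  · simp [h]
  have hPm := isMatching_of_mem_starAt hM
  obtain ⟨N, hN, hPN⟩ := hP hPm
  have hR := N.2.isMatching.card_disjointEdges_le hPm
  have hpos := numPM_pos (k - P.card - 1)
  rcases hR.eq_or_lt with hR | hR
  · have hM0 : IsPM (disjointEdges N.1 P ∪ P) := by
      refine (N.2.isMatching.disjointEdges_union hPm).isPM ?_
      rw [card_disjointEdges_union]
      have := hPm.card_le
      omega
    have hsub : starAt F P ⊆ insert ⟨_, hM0⟩ ((disjointEdges N.1 P).biUnion fun e =>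
        (starAt univ (insert e P)).erase ⟨_, hM0⟩) := by
      intro M hM
      obtain ⟨e, he, heM⟩ := mem_biUnion.1
        (starAt_subset_biUnion (fun M hM => hF M hM N hN) hPN hM)
      by_cases h : M = ⟨_, hM0⟩
      · exact mem_insert.2 (Or.inl h)
      · exact mem_insert_of_mem (mem_biUnion.2
          ⟨e, he, mem_erase.2 ⟨h, starAt_subset_starAt_univ _ _ heM⟩⟩)
    refine (card_le_card hsub).trans ((card_insert_le _ _).trans ?_)
    rw [← hR]
    refine Nat.add_le_add_right (card_biUnion_le_card_mul _ _ _ fun e he => ?_) 1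
    rw [card_erase_of_mem]
    · refine Nat.sub_le_sub_right ((card_starAt_le _ _).trans (le_of_eq ?_)) 1
      rw [card_insert_of_notMem (notMem_of_mem_disjointEdges he), hR, Nat.sub_sub]
    · exact mem_starAt.2 ⟨mem_univ _, insert_subset (mem_union_left _ he) subset_union_right⟩
  · have h := card_starAt_le_card_mul (fun M hM => hF M hM N hN) hPN
      (u := numPM (k - P.card - 1)) fun P' hP' => (card_starAt_le F P').trans
        (le_of_eq (by rw [hP', Nat.sub_sub]))
    have hle := le_numPM (k - P.card - 1)
    obtain ⟨n, hn⟩ : ∃ n, k - P.card = n + 1 := ⟨k - P.card - 1, by omega⟩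
    rw [hn] at hR hle hpos h ⊢
    simp only [Nat.add_sub_cancel] at hle hpos h ⊢
    obtain ⟨d, hd⟩ : ∃ d, numPM n = d + 1 := ⟨numPM n - 1, by omega⟩
    rw [hd] at hle h ⊢
    have : (disjointEdges N.1 P).card * (d + 1) ≤ n * (d + 1) :=
      Nat.mul_le_mul_right _ (by omega)
    simp only [Nat.add_sub_cancel]
    nlinarith

theorem two_mul_card_starAt_le {k : ℕ} {F : Finset (PM (2 * k))}
    (hF : ∀ M ∈ F, ∀ N ∈ F, 2 ≤ (M.1 ∩ N.1).card) {P : Finset (Sym2 (Fin (2 * k)))}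
    (hP : ∃ N ∈ F, P ∩ N.1 = ∅) {u : ℕ}
    (hu : ∀ P', P'.card = P.card + 1 → (starAt F P').card ≤ u) :
    2 * (starAt F P).card ≤ (k - P.card) * u := by
  rcases (starAt F P).eq_empty_or_nonempty with h | ⟨M, hM⟩
  · simp [h]
  have hPm := isMatching_of_mem_starAt hM
  obtain ⟨N, hN, hPN⟩ := hP
  have hcount := sum_card_bipartiteAbove_eq_sum_card_bipartiteBelow
    (s := starAt F P) (t := disjointEdges N.1 P) fun M e => e ∈ M.1
  calc 2 * (starAt F P).card = ∑ M ∈ starAt F P, 2 := by simp [mul_comm]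
    _ ≤ ∑ M ∈ starAt F P, ((disjointEdges N.1 P).bipartiteAbove (fun M e => e ∈ M.1) M).card := by
      refine sum_le_sum fun M hM => (hF M (mem_starAt.1 hM).1 N hN).trans (card_le_card ?_)
      intro e he
      obtain ⟨heM, heN⟩ := mem_inter.1 he
      refine (mem_bipartiteAbove _).2
        ⟨M.2.isMatching.mem_disjointEdges (mem_starAt.1 hM).2 heM heN fun heP => ?_, heM⟩
      simpa [hPN] using mem_inter.2 ⟨heP, heN⟩
    _ = _ := hcount
    _ ≤ ∑ e ∈ disjointEdges N.1 P, u := by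
      refine sum_le_sum fun e he => le_trans (card_le_card ?_)
        (hu (insert e P) (card_insert_of_notMem (notMem_of_mem_disjointEdges he)))
      intro M hM
      obtain ⟨hM, heM⟩ := (mem_bipartiteBelow _).1 hM
      exact mem_starAt.2 ⟨(mem_starAt.1 hM).1, insert_subset heM (mem_starAt.1 hM).2⟩
    _ ≤ (k - P.card) * u := by
      rw [sum_const, smul_eq_mul]
      exact Nat.mul_le_mul_right _ (N.2.isMatching.card_disjointEdges_le hPm)

theorem card_disjointEdges_pair_le {k : ℕ} {N : Finset (Sym2 (Fin (2 * k)))} (hN : IsPM N)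
    {p q : Sym2 (Fin (2 * k))} (hpq : IsMatching {p, q}) (hp : p ∈ N) (hq : q ∉ N) :
    (disjointEdges N {p, q}).card ≤ k - 3 := by
  induction q with | _ x y
  have hxy : x ≠ y := by simpa using hpq.1 s(x, y) (by simp)
  obtain ⟨e, ⟨he, hxe⟩, -⟩ := hN.2 x
  obtain ⟨f, ⟨hf, hyf⟩, -⟩ := hN.2 y
  have hef : e ≠ f := by
    rintro rfl
    exact hq ((Sym2.mem_and_mem_iff hxy).1 ⟨hxe, hyf⟩ ▸ he)
  have hpe : ∀ v, v ∈ s(x, y) → v ∉ p := fun v hv hvp =>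
    hq (hpq.2 p (by simp) s(x, y) (by simp) v hvp hv ▸ hp)
  have hep : e ≠ p := by
    rintro rfl
    exact hpe x (Sym2.mem_mk_left x y) hxe
  have hfp : f ≠ p := by
    rintro rfl
    exact hpe y (Sym2.mem_mk_right x y) hyf
  have hdisj : Disjoint (disjointEdges N {p, s(x, y)}) {e, f, p} := by
    refine disjoint_left.2 fun g hg hg' => ?_
    have h := (mem_disjointEdges.1 hg).2
    simp only [mem_insert, mem_singleton] at hg'
    rcases hg' with rfl | rfl | rfl
    · exact h s(x, y) (by simp) x hxe (Sym2.mem_mk_left x y)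
    · exact h s(x, y) (by simp) y hyf (Sym2.mem_mk_right x y)
    · exact notMem_of_mem_disjointEdges hg (by simp)
  have hsub : disjointEdges N {p, s(x, y)} ∪ {e, f, p} ⊆ N := by
    refine union_subset (filter_subset _ _) ?_
    simp [insert_subset_iff, he, hf, hp]
  have hcard := card_le_card hsub
  rw [card_union_of_disjoint hdisj, card_eq_three.2 ⟨e, f, p, hef, hep, hfp, rfl⟩] at hcard
  have := hN.two_mul_card
  omega

/-- The members of `F` through a pair which meets every member of `F`. -/
theorem card_starAt_pair_le {k : ℕ} {F : Finset (PM (2 * k))}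
    (hF : ∀ M ∈ F, ∀ N ∈ F, 2 ≤ (M.1 ∩ N.1).card) {P : Finset (Sym2 (Fin (2 * k)))}
    (hP : P.card = 2) (hP1 : IsMatching P → ∃ N ∈ F, (P ∩ N.1).card ≤ 1)
    (hP0 : ∀ N ∈ F, (P ∩ N.1).Nonempty) {u : ℕ}
    (hu : ∀ P', P'.card = 3 → (starAt F P').card ≤ u) :
    (starAt F P).card ≤ (k - 3) * u := by
  rcases (starAt F P).eq_empty_or_nonempty with h | ⟨M, hM⟩
  · simp [h]
  have hPm := isMatching_of_mem_starAt hM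
  obtain ⟨N, hN, hPN⟩ := hP1 hPm
  obtain ⟨p, hp⟩ := hP0 N hN
  obtain ⟨hpP, hpN⟩ := mem_inter.1 hp
  obtain ⟨q, hqp, hq⟩ : ∃ q, q ≠ p ∧ P = {p, q} := by
    obtain ⟨a, b, hab, rfl⟩ := card_eq_two.1 hP
    simp only [mem_insert, mem_singleton] at hpP
    rcases hpP with rfl | rfl
    · exact ⟨b, hab.symm, rfl⟩
    · exact ⟨a, hab, pair_comm _ _⟩
  subst hq
  have hqN : q ∉ N.1 := fun hqN => by
    have : ({p, q} : Finset _) ⊆ {p, q} ∩ N.1 := by simp [hpN, hqN]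
    have := card_le_card this
    omega
  exact (card_starAt_le_card_mul (fun M hM => hF M hM N hN) hPN
    (fun P' hP' => hu P' (by omega))).trans
    (Nat.mul_le_mul_right _ (card_disjointEdges_pair_le N.2 hPm hpN hqN))

theorem two_le_card_pair_inter {α : Type*} [DecidableEq α] {a b : α} (hab : a ≠ b)
    (N : Finset α) : 2 ≤ (({a, b} : Finset α) ∩ N).card ↔ a ∈ N ∧ b ∈ N := by
  by_cases ha : a ∈ N <;> by_cases hb : b ∈ N <;>
    simp [insert_inter_of_mem, insert_inter_of_notMem, ha, hb, hab]

theorem two_le_card_triple_inter {α : Type*} [DecidableEq α] {a b c : α} (hab : a ≠ b)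
    (hac : a ≠ c) (hbc : b ≠ c) (N : Finset α) :
    2 ≤ (({a, b, c} : Finset α) ∩ N).card ↔
      (a ∈ N ∧ b ∈ N) ∨ (a ∈ N ∧ c ∈ N) ∨ (b ∈ N ∧ c ∈ N) := by
  by_cases ha : a ∈ N <;> by_cases hb : b ∈ N <;> by_cases hc : c ∈ N <;>
    simp [insert_inter_of_mem, insert_inter_of_notMem, ha, hb, hc, hab, hac, hbc]

theorem pair_mem_starAt {n : ℕ} {F : Finset (PM n)} {a b : Sym2 (Fin n)} {M : PM n} :
    M ∈ starAt F {a, b} ↔ M ∈ F ∧ a ∈ M.1 ∧ b ∈ M.1 := by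
  simp [mem_starAt, insert_subset_iff]

theorem exists_ne_mem_of_two_le_card {α : Type*} {s : Finset α} (h : 2 ≤ s.card) (a : α) :
    ∃ b ∈ s, b ≠ a :=
  exists_mem_ne (by omega) a

/-- Bounds for a 2-intersecting family in terms of a matching `Q` which every member meets at
least twice, when no matching with at most three edges has that property. -/
theorem card_le_of_transversal {k : ℕ} (hk : 4 ≤ k) {F : Finset (PM (2 * k))}
    (hF : ∀ M ∈ F, ∀ N ∈ F, 2 ≤ (M.1 ∩ N.1).card)
    (hno : ∀ P, IsMatching P → P.card ≤ 3 → ∃ N ∈ F, (P ∩ N.1).card ≤ 1)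
    {Q : Finset (Sym2 (Fin (2 * k)))} (hQ : IsMatching Q)
    (hQF : ∀ N ∈ F, 2 ≤ (Q ∩ N.1).card) {u : ℕ}
    (hu : ∀ P', P'.card = 3 → (starAt F P').card ≤ u) :
    2 * F.card ≤ Q.card.choose 2 * ((k - 2) * u) ∨
    2 * F.card ≤ 2 * ((k - 3) * u) + 2 * ((Q.card - 2) * ((k - 2) * u)) ∨
    2 * F.card ≤ 2 * ((Q.card - 1) * ((k - 3) * u)) + (k - 2) * u := by
  have hB : ∀ a b, a ≠ b → ¬ (∀ N ∈ F, a ∈ N.1 ∨ b ∈ N.1) →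
      2 * (starAt F {a, b}).card ≤ (k - 2) * u := by
    intro a b hab h
    push Not at h
    obtain ⟨N, hN, ha, hb⟩ := h
    have hc := card_pair hab
    have := two_mul_card_starAt_le hF (P := {a, b})
      ⟨N, hN, by simp [insert_inter_of_notMem, ha, hb]⟩
      fun P' hP' => hu P' (by omega)
    rwa [hc] at this
  have hA : ∀ a b, a ≠ b → (starAt F {a, b}).card ≤ (k - 3) * u := by
    intro a b hab
    have hc := card_pair hab
    by_cases h : ∀ N ∈ F, a ∈ N.1 ∨ b ∈ N.1
    · refine card_starAt_pair_le hF hc (fun hP => hno _ hP (by omega)) (fun N hN => ?_) hu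
      rcases h N hN with h | h
      · exact ⟨a, by simp [h]⟩
      · exact ⟨b, by simp [h]⟩
    · have h1 := hB a b hab h
      have h2 : (k - 2) * u ≤ 2 * (k - 3) * u := Nat.mul_le_mul_right _ (by omega)
      rw [mul_assoc] at h2
      omega
  by_cases h3 : ∃ a ∈ Q, ∃ b ∈ Q, ∃ c ∈ Q, a ≠ b ∧ a ≠ c ∧ b ≠ c ∧
      (∀ N ∈ F, a ∈ N.1 ∨ b ∈ N.1) ∧ (∀ N ∈ F, a ∈ N.1 ∨ c ∈ N.1)
  · right; right
    obtain ⟨a, haQ, b, hbQ, c, hcQ, hab, hac, hbc, h1, h2⟩ := h3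
    have hbc' : ¬ (∀ N ∈ F, b ∈ N.1 ∨ c ∈ N.1) := by
      intro h
      obtain ⟨N, hN, hN1⟩ := hno {a, b, c}
        (hQ.mono (by simp [insert_subset_iff, haQ, hbQ, hcQ])) card_le_three
      have h' : ¬ 2 ≤ (({a, b, c} : Finset _) ∩ N.1).card := by omega
      rw [two_le_card_triple_inter hab hac hbc] at h'
      have := h N hN
      have := h1 N hN
      have := h2 N hN
      tauto
    have hsub : F ⊆ (Q.erase a).biUnion (fun q => starAt F {a, q}) ∪ starAt F {b, c} := by
      intro M hM
      by_cases ha : a ∈ M.1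
      · obtain ⟨q, hq, hqa⟩ := exists_ne_mem_of_two_le_card (hQF M hM) a
        obtain ⟨hqQ, hqM⟩ := mem_inter.1 hq
        exact mem_union_left _ (mem_biUnion.2 ⟨q, mem_erase.2 ⟨hqa, hqQ⟩,
          pair_mem_starAt.2 ⟨hM, ha, hqM⟩⟩)
      · exact mem_union_right _ (pair_mem_starAt.2 ⟨hM, (h1 M hM).resolve_left ha,
          (h2 M hM).resolve_left ha⟩)
    have h4 := (card_le_card hsub).trans (card_union_le _ _)
    have h5 := card_biUnion_le_card_mul (Q.erase a) (fun q => starAt F {a, q}) ((k - 3) * u)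
      fun q hq => hA a q (mem_erase.1 hq).1.symm
    rw [card_erase_of_mem haQ] at h5
    have h6 := hB b c hbc hbc'
    omega
  by_cases h2 : ∃ a ∈ Q, ∃ b ∈ Q, a ≠ b ∧ ∀ N ∈ F, a ∈ N.1 ∨ b ∈ N.1
  · right; left
    obtain ⟨a, haQ, b, hbQ, hab, h⟩ := h2
    have hsub : F ⊆ starAt F {a, b} ∪ ((Q \ {a, b}).biUnion (fun q => starAt F {a, q}) ∪
        (Q \ {a, b}).biUnion (fun q => starAt F {b, q})) := by
      intro M hM
      by_cases hMab : a ∈ M.1 ∧ b ∈ M.1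
      · exact mem_union_left _ (pair_mem_starAt.2 ⟨hM, hMab⟩)
      refine mem_union_right _ ?_
      rcases h M hM with ha | hb
      · obtain ⟨q, hq, hqa⟩ := exists_ne_mem_of_two_le_card (hQF M hM) a
        obtain ⟨hqQ, hqM⟩ := mem_inter.1 hq
        have hqb : q ≠ b := by rintro rfl; exact hMab ⟨ha, hqM⟩
        exact mem_union_left _ (mem_biUnion.2 ⟨q, by simp [hqQ, hqa, hqb],
          pair_mem_starAt.2 ⟨hM, ha, hqM⟩⟩)
      · obtain ⟨q, hq, hqb⟩ := exists_ne_mem_of_two_le_card (hQF M hM) b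
        obtain ⟨hqQ, hqM⟩ := mem_inter.1 hq
        have hqa : q ≠ a := by rintro rfl; exact hMab ⟨hqM, hb⟩
        exact mem_union_right _ (mem_biUnion.2 ⟨q, by simp [hqQ, hqa, hqb],
          pair_mem_starAt.2 ⟨hM, hb, hqM⟩⟩)
    have hcard : (Q \ {a, b}).card = Q.card - 2 := by
      rw [card_sdiff_of_subset (by simp [insert_subset_iff, haQ, hbQ]), card_pair hab]
    have hdiv : ∀ m : ℕ, 2 * m ≤ (k - 2) * u → m ≤ (k - 2) * u / 2 := fun m hm => by omega
    have h4 := (card_le_card hsub).trans ((card_union_le _ _).trans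
      (Nat.add_le_add_left (card_union_le _ _) _))
    have h5 := card_biUnion_le_card_mul (Q \ {a, b}) (fun q => starAt F {a, q})
      ((k - 2) * u / 2) fun q hq => by
        simp only [mem_sdiff, mem_insert, mem_singleton, not_or] at hq
        exact hdiv _ (hB a q (Ne.symm hq.2.1) fun hq' =>
          h3 ⟨a, haQ, b, hbQ, q, hq.1, hab, (Ne.symm hq.2.1), (Ne.symm hq.2.2), h, hq'⟩)
    have h6 := card_biUnion_le_card_mul (Q \ {a, b}) (fun q => starAt F {b, q})
      ((k - 2) * u / 2) fun q hq => by
        simp only [mem_sdiff, mem_insert, mem_singleton, not_or] at hq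
        exact hdiv _ (hB b q (Ne.symm hq.2.2) fun hq' =>
          h3 ⟨b, hbQ, a, haQ, q, hq.1, hab.symm, (Ne.symm hq.2.2), (Ne.symm hq.2.1),
            fun N hN => (h N hN).symm, hq'⟩)
    rw [hcard] at h5 h6
    have h7 := hA a b hab
    have h8 : 2 * ((Q.card - 2) * ((k - 2) * u / 2)) ≤ (Q.card - 2) * ((k - 2) * u) := by
      rw [mul_left_comm]
      exact Nat.mul_le_mul_left _ (Nat.mul_div_le _ _)
    omega
  · left
    have hsub : F ⊆ (Q.powersetCard 2).biUnion (fun P => starAt F P) := by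
      intro M hM
      obtain ⟨P, hPQ, hP⟩ := exists_subset_card_eq (hQF M hM)
      exact mem_biUnion.2 ⟨P, mem_powersetCard.2 ⟨hPQ.trans inter_subset_left, hP⟩,
        mem_starAt.2 ⟨hM, hPQ.trans inter_subset_right⟩⟩
    have h5 := card_biUnion_le_card_mul (Q.powersetCard 2) (fun P => starAt F P)
      ((k - 2) * u / 2) fun P hP => by
        obtain ⟨hPQ, hP2⟩ := mem_powersetCard.1 hP
        obtain ⟨a, b, hab, rfl⟩ := card_eq_two.1 hP2
        have := hB a b hab fun h => h2 ⟨a, hPQ (by simp), b, hPQ (by simp), hab, h⟩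
        omega
    rw [card_powersetCard] at h5
    have h4 := card_le_card hsub
    have h8 : 2 * (Q.card.choose 2 * ((k - 2) * u / 2)) ≤ Q.card.choose 2 * ((k - 2) * u) := by
      rw [mul_left_comm]
      exact Nat.mul_le_mul_left _ (Nat.mul_div_le _ _)
    omega

theorem card_starAt_pair_sdiff_le {k : ℕ} {F : Finset (PM (2 * k))}
    (hF : ∀ M ∈ F, ∀ N ∈ F, 2 ≤ (M.1 ∩ N.1).card)
    (hno : ∀ P, IsMatching P → P.card = 2 → ∃ N ∈ F, (P ∩ N.1).card ≤ 1)
    {a b c : Sym2 (Fin (2 * k))} (hab : a ≠ b) (hac : a ≠ c) (hbc : b ≠ c)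
    (hQ : IsMatching {a, b, c})
    (hQF : ∀ N ∈ F, 2 ≤ (({a, b, c} : Finset _) ∩ N.1).card)
    (hab' : ∀ e, e ≠ c → ∃ N ∈ F, (({a, b, e} : Finset _) ∩ N.1).card ≤ 1) :
    (starAt F {a, b} \ starAt F {a, b, c}).card ≤ (k - 4) * ((k - 3) * numPM (k - 4)) := by
  have hQ2 : IsMatching {a, b} := hQ.mono (by simp [insert_subset_iff])
  obtain ⟨N, hN, hPN⟩ := hno {a, b} hQ2 (card_pair hab)
  have hPN' : ¬ 2 ≤ (({a, b} : Finset _) ∩ N.1).card := by omega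
  rw [two_le_card_pair_inter hab] at hPN'
  have hN3 := hQF N hN
  rw [two_le_card_triple_inter hab hac hbc] at hN3
  have hcN : c ∈ N.1 := by tauto
  have hR : (disjointEdges N.1 {a, b}).card ≤ k - 3 := by
    by_cases ha : a ∈ N.1
    · exact card_disjointEdges_pair_le N.2 hQ2 ha (by tauto)
    · rw [pair_comm] at hQ2 ⊢
      exact card_disjointEdges_pair_le N.2 hQ2 (by tauto) ha
  have hcR : c ∈ disjointEdges N.1 {a, b} :=
    hQ.mem_disjointEdges (by simp [insert_subset_iff]) (by simp) hcN
      (by simp [hac.symm, hbc.symm])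
  have hsub : starAt F {a, b} \ starAt F {a, b, c} ⊆
      ((disjointEdges N.1 {a, b}).erase c).biUnion fun e => starAt F {a, b, e} := by
    intro M hM
    obtain ⟨hM, hMc⟩ := mem_sdiff.1 hM
    obtain ⟨e, he, heM⟩ := mem_biUnion.1
      (starAt_subset_biUnion (fun M hM => hF M hM N hN) hPN hM)
    have hins : (insert e {a, b} : Finset (Sym2 (Fin (2 * k)))) = {a, b, e} := by
      rw [insert_comm, pair_comm e b]
    rw [hins] at heM
    refine mem_biUnion.2 ⟨e, mem_erase.2 ⟨?_, he⟩, heM⟩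
    rintro rfl
    exact hMc heM
  refine (card_le_card hsub).trans ((card_biUnion_le_card_mul _ _ ((k - 3) * numPM (k - 4))
    fun e he => ?_).trans (Nat.mul_le_mul_right _ ?_))
  · obtain ⟨hec, he⟩ := mem_erase.1 he
    have heP := notMem_of_mem_disjointEdges he
    simp only [mem_insert, mem_singleton, not_or] at heP
    have hc3 : ({a, b, e} : Finset (Sym2 (Fin (2 * k)))).card = 3 :=
      card_eq_three.2 ⟨a, b, e, hab, heP.1 ∘ Eq.symm, heP.2 ∘ Eq.symm, rfl⟩
    have := card_starAt_le_sub_mul hF (P := {a, b, e}) (fun _ => hab' e hec)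
      (u := numPM (k - 4)) fun P' hP' => (card_starAt_le F P').trans (by rw [hP', hc3])
    rwa [hc3] at this
  · rw [card_erase_of_mem hcR]
    omega

theorem card_le_of_transversal_three {k : ℕ} (hk : 4 ≤ k) {F : Finset (PM (2 * k))}
    (hF : ∀ M ∈ F, ∀ N ∈ F, 2 ≤ (M.1 ∩ N.1).card)
    (hno : ∀ P, IsMatching P → P.card = 2 → ∃ N ∈ F, (P ∩ N.1).card ≤ 1)
    {Q : Finset (Sym2 (Fin (2 * k)))} (hQ : IsMatching Q) (hQ3 : Q.card = 3)
    (hQF : ∀ N ∈ F, 2 ≤ (Q ∩ N.1).card) : F.card ≤ numPM (k - 2) := by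
  obtain ⟨m, rfl⟩ : ∃ m, k = m + 4 := ⟨k - 4, by omega⟩
  have hpos := numPM_pos m
  have hD3 : ∀ P, P.card = 3 → (starAt F P).card ≤ numPM (m + 1) := fun P hP =>
    (card_starAt_le F P).trans (by rw [hP]; exact le_rfl)
  have hfin2 : numPM (m + 4 - 2) = (2 * m + 3) * numPM (m + 1) := by
    simp only [Nat.reduceSubDiff, numPM]; ring
  by_cases hα : ∃ a b c, a ≠ b ∧ a ≠ c ∧ b ≠ c ∧ Q = {a, b, c} ∧
      ∃ e, e ≠ c ∧ ∀ N ∈ F, 2 ≤ (({a, b, e} : Finset _) ∩ N.1).card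
  · obtain ⟨a, b, c, hab, hac, hbc, rfl, e, hec, he⟩ := hα
    have hQF' : ∀ N ∈ F, (a ∈ N.1 ∧ b ∈ N.1) ∨ (a ∈ N.1 ∧ c ∈ N.1) ∨ (b ∈ N.1 ∧ c ∈ N.1) :=
      fun N hN => (two_le_card_triple_inter hab hac hbc N.1).1 (hQF N hN)
    have hab2 : IsMatching {a, b} := hQ.mono (by simp [insert_subset_iff])
    have heab : e ≠ a ∧ e ≠ b := by
      obtain ⟨N, hN, hN1⟩ := hno _ hab2 (card_pair hab)
      have := he N hN
      constructor
      · rintro rfl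
        rw [pair_comm, insert_idem] at this
        omega
      · rintro rfl
        simp only [pair_eq_singleton] at this
        omega
    have hsub : F ⊆ starAt F {a, b} ∪ (starAt F {a, c, e} ∪ starAt F {b, c, e}) := by
      intro M hM
      have h1 := hQF' M hM
      have h2 := (two_le_card_triple_inter hab heab.1.symm heab.2.symm M.1).1 (he M hM)
      simp only [mem_union, mem_starAt, insert_subset_iff, singleton_subset_iff]
      tauto
    have h1 := (card_le_card hsub).trans ((card_union_le _ _).trans
      (Nat.add_le_add_left (card_union_le _ _) _))
    have h2 := card_starAt_pair_le hF (card_pair hab) (fun h => hno _ h (card_pair hab))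
      (fun N hN => by
        rcases hQF' N hN with h | h | h
        · exact ⟨a, by simp [h.1]⟩
        · exact ⟨a, by simp [h.1]⟩
        · exact ⟨b, by simp [h.1]⟩) hD3
    have h3 := hD3 {a, c, e} (card_eq_three.2 ⟨a, c, e, hac, heab.1.symm, hec.symm, rfl⟩)
    have h4 := hD3 {b, c, e} (card_eq_three.2 ⟨b, c, e, hbc, heab.2.symm, hec.symm, rfl⟩)
    rw [hfin2]
    rw [show m + 4 - 3 = m + 1 by omega] at h2
    nlinarith
  · push Not at hα
    obtain ⟨a, b, c, hab, hac, hbc, rfl⟩ := card_eq_three.1 hQ3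
    have e1 : ({a, b, c} : Finset (Sym2 (Fin (2 * (m + 4))))) = {a, c, b} := by
      rw [pair_comm b c]
    have e2 : ({a, b, c} : Finset (Sym2 (Fin (2 * (m + 4))))) = {b, c, a} := by
      rw [insert_comm a b, pair_comm a c]
    have hsub : F ⊆ starAt F {a, b, c} ∪ ((starAt F {a, b} \ starAt F {a, b, c}) ∪
        ((starAt F {a, c} \ starAt F {a, c, b}) ∪ (starAt F {b, c} \ starAt F {b, c, a}))) := by
      intro M hM
      have h1 := (two_le_card_triple_inter hab hac hbc M.1).1 (hQF M hM)
      simp only [mem_union, mem_sdiff, mem_starAt, insert_subset_iff, singleton_subset_iff]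
      tauto
    have h0 := (card_le_card hsub).trans ((card_union_le _ _).trans
      (Nat.add_le_add_left ((card_union_le _ _).trans
        (Nat.add_le_add_left (card_union_le _ _) _)) _))
    have key : ∀ a' b' c', a' ≠ b' → a' ≠ c' → b' ≠ c' →
        ({a, b, c} : Finset (Sym2 (Fin (2 * (m + 4))))) = {a', b', c'} →
        (starAt F {a', b'} \ starAt F {a', b', c'}).card ≤ m * ((m + 1) * numPM m) := by
      intro a' b' c' h1 h2 h3 h
      rw [h] at hQ hQF
      refine card_starAt_pair_sdiff_le hF hno h1 h2 h3 hQ hQF fun e he => ?_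
      obtain ⟨N, hN, hN'⟩ := hα a' b' c' h1 h2 h3 h e he
      exact ⟨N, hN, by omega⟩
    have h1 := hD3 _ hQ3
    have h2 := key a b c hab hac hbc rfl
    have h3 := key a c b hac hab hbc.symm e1
    have h4 := key b c a hbc hab.symm hac.symm e2
    rw [hfin2]
    simp only [numPM] at h1 ⊢
    nlinarith [Nat.zero_le (m * m * numPM m), Nat.zero_le (m * numPM m)]

theorem card_starAt_le_descFactorial_mul {k : ℕ} {F : Finset (PM (2 * k))}
    (hF : ∀ M ∈ F, ∀ N ∈ F, 2 ≤ (M.1 ∩ N.1).card) {t v : ℕ}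
    (hno : ∀ P, IsMatching P → P.card < t → ∃ N ∈ F, (P ∩ N.1).card ≤ 1)
    (hv : ∀ P, P.card = t → (starAt F P).card ≤ v) (i : ℕ) (P : Finset (Sym2 (Fin (2 * k))))
    (hP : P.card + i = t) : (starAt F P).card ≤ (k - P.card).descFactorial i * v := by
  induction i generalizing P with
  | zero => simpa using hv P hP
  | succ i ih =>
    refine (card_starAt_le_sub_mul hF (fun h => hno P h (by omega)) fun P' hP' => ih P' (by omega)
      |>.trans (le_of_eq (by rw [hP']))).trans (le_of_eq ?_)
    rw [← mul_assoc]
    congr 1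
    obtain h | ⟨s, h⟩ : k - P.card = 0 ∨ ∃ s, k - P.card = s + 1 := by
      rcases k - P.card with _ | s
      · exact Or.inl rfl
      · exact Or.inr ⟨s, rfl⟩
    · simp [h]
    · rw [h, Nat.succ_descFactorial_succ, show k - (P.card + 1) = s by omega]

/-- A 2-intersecting family admitting a transversal matching with at least four edges, but none
with at most three, is bounded by `X` as soon as two numerical inequalities hold. -/
theorem card_le_of_four_le_transversal {k : ℕ} (hk : 4 ≤ k) {F : Finset (PM (2 * k))}
    (hF : ∀ M ∈ F, ∀ N ∈ F, 2 ≤ (M.1 ∩ N.1).card)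
    (hno : ∀ P, IsMatching P → P.card ≤ 3 → ∃ N ∈ F, (P ∩ N.1).card ≤ 1)
    {Q : Finset (Sym2 (Fin (2 * k)))} (hQ : IsMatching Q) (hQ4 : 4 ≤ Q.card)
    (hQF : ∀ N ∈ F, 2 ≤ (Q ∩ N.1).card) {u X : ℕ}
    (hu : ∀ P', P'.card = 3 → (starAt F P').card ≤ u)
    (hX : Q.card.choose 2 * ((k - 2) * u) ≤ 2 * X)
    (hX4 : Q.card = 4 → 6 * ((k - 3) * u) + (k - 2) * u ≤ 2 * X) : F.card ≤ X := by
  have hAB : (k - 3) * u ≤ (k - 2) * u := Nat.mul_le_mul_right _ (by omega)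
  obtain ⟨t, ht⟩ : ∃ t, Q.card = t + 4 := ⟨Q.card - 4, by omega⟩
  have hch : 2 * (t + 4).choose 2 = (t + 4) * (t + 3) := by
    rw [Nat.choose_two_right, Nat.mul_div_cancel' (Nat.even_mul_pred_self _).two_dvd]
    rfl
  have key := card_le_of_transversal hk hF hno hQ hQF hu
  rw [ht] at key hX hX4
  generalize (k - 3) * u = A at *
  generalize (k - 2) * u = B at *
  generalize (t + 4).choose 2 = C at *
  rcases key with h | h | h
  · omega
  · rw [show t + 4 - 2 = t + 2 by omega] at h
    have h1 : (2 * t + 6) * B ≤ C * B := Nat.mul_le_mul_right _ (by nlinarith)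
    nlinarith
  · rw [show t + 4 - 1 = t + 3 by omega] at h
    rcases Nat.eq_zero_or_pos t with rfl | h0
    · have := hX4 rfl
      omega
    · have h1 : (2 * t + 7) * B ≤ C * B := Nat.mul_le_mul_right _ (by nlinarith)
      have h2 : (t + 3) * A ≤ (t + 3) * B := Nat.mul_le_mul_left _ hAB
      nlinarith

theorem mul_descFactorial_mul_numPM_le {s : ℕ} (hs : 3 ≤ s) (t n : ℕ) (hn : 1 ≤ n)
    (h : t + n = s) :
    (t + 4) * (t + 3) * (s.descFactorial t * numPM n) ≤ 12 * numPM s := by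
  induction t generalizing n with
  | zero => simp [show n = s by omega]
  | succ t ih =>
    refine le_trans ?_ (ih (n + 1) (by omega) (by omega))
    rw [Nat.descFactorial_succ, show s - t = n + 1 by omega, numPM]
    have h1 : (t + 5) * (n + 1) ≤ (t + 3) * (2 * n + 1) := by
      rcases Nat.eq_zero_or_pos t with rfl | h0
      · omega
      · nlinarith
    have h2 := Nat.mul_le_mul_right ((t + 4) * (s.descFactorial t * numPM n)) h1
    nlinarith

theorem factorial_le_four_mul_numPM (m : ℕ) : (m + 8).factorial ≤ 4 * numPM (m + 6) := by
  induction m with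
  | zero => decide
  | succ m ih =>
    rw [show m + 1 + 8 = (m + 8) + 1 by ring, Nat.factorial_succ,
      show m + 1 + 6 = (m + 6) + 1 by ring, numPM]
    nlinarith

theorem choose_two_mul_le_two_mul_numPM {k τ : ℕ} (hk : 7 ≤ k) (h4 : 4 ≤ τ) (hτ : τ ≤ k)
    (h : k = 7 → τ < 7) :
    τ.choose 2 * ((k - 2) * ((k - 3).descFactorial (τ - 3) * numPM (k - τ))) ≤
      2 * numPM (k - 2) := by
  obtain ⟨t, rfl⟩ : ∃ t, τ = t + 4 := ⟨τ - 4, by omega⟩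
  obtain ⟨n, rfl⟩ : ∃ n, k = t + 4 + n := ⟨k - (t + 4), by omega⟩
  have hch : 2 * (t + 4).choose 2 = (t + 4) * (t + 3) := by
    rw [Nat.choose_two_right, Nat.mul_div_cancel' (Nat.even_mul_pred_self _).two_dvd]
    rfl
  rw [show t + 4 + n - 2 = t + n + 2 by omega, show t + 4 + n - 3 = t + n + 1 by omega,
    show t + 4 - 3 = t + 1 by omega, show t + 4 + n - (t + 4) = n by omega,
    Nat.succ_descFactorial_succ, mul_assoc (t + n + 1)]
  rcases Nat.eq_zero_or_pos n with rfl | hn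
  · have h1 := factorial_le_four_mul_numPM (t - 4)
    rw [show t - 4 + 8 = t + 4 by omega, show t - 4 + 6 = t + 2 by omega] at h1
    simp only [Nat.factorial_succ] at h1
    simp only [add_zero, Nat.descFactorial_self, numPM, mul_one] at h1 ⊢
    have h2 : 2 * ((t + 4).choose 2 * ((t + 2) * ((t + 1) * t.factorial))) =
        (t + 3 + 1) * ((t + 2 + 1) * ((t + 1 + 1) * ((t + 1) * t.factorial))) := by
      rw [← mul_assoc 2, hch]; ring
    linarith
  · have h1 := mul_descFactorial_mul_numPM_le (s := t + n) (by omega) t n hn rfl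
    generalize (t + n).descFactorial t * numPM n = c at *
    have h2 := Nat.mul_le_mul_left ((t + n + 2) * (t + n + 1)) h1
    have h3 : 3 * ((t + n + 2) * (t + n + 1)) ≤ (2 * (t + n) + 3) * (2 * (t + n) + 1) := by
      nlinarith
    have h4 := Nat.mul_le_mul_right (4 * numPM (t + n)) h3
    have h5 : numPM (t + n + 2) = (2 * (t + n) + 3) * ((2 * (t + n) + 1) * numPM (t + n)) := by
      simp only [numPM]; ring
    rw [h5]
    have h6 : 2 * ((t + 4).choose 2 * ((t + n + 2) * ((t + n + 1) * c))) =
        (t + n + 2) * (t + n + 1) * ((t + 4) * (t + 3) * c) := by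
      rw [← mul_assoc 2, hch]; ring
    nlinarith

theorem six_mul_add_le_two_mul_numPM {k : ℕ} (hk : 5 ≤ k) :
    6 * ((k - 3) * ((k - 3) * numPM (k - 4))) + (k - 2) * ((k - 3) * numPM (k - 4)) ≤
      2 * numPM (k - 2) := by
  obtain ⟨m, rfl⟩ : ∃ m, k = m + 5 := ⟨k - 5, by omega⟩
  have h0 : numPM (m + 3) =
      (2 * (m + 1 + 1) + 1) * ((2 * (m + 1) + 1) * numPM (m + 1)) := rfl
  rw [show m + 5 - 3 = m + 2 by omega, show m + 5 - 4 = m + 1 by omega,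
    show m + 5 - 2 = m + 3 by omega, h0]
  generalize numPM (m + 1) = D
  have h : 6 * ((m + 2) * (m + 2)) + (m + 3) * (m + 2) ≤
    2 * ((2 * (m + 1 + 1) + 1) * (2 * (m + 1) + 1)) := by nlinarith
  have := Nat.mul_le_mul_right D h
  nlinarith

/-- The upper bound in terms of a smallest matching `Q` which every member of the family meets at
least twice. -/
theorem card_le_of_minimal_transversal {k : ℕ} (hk : 3 ≤ k) {F : Finset (PM (2 * k))}
    (hF : ∀ M ∈ F, ∀ N ∈ F, 2 ≤ (M.1 ∩ N.1).card)
    {Q : Finset (Sym2 (Fin (2 * k)))} (hQ : IsMatching Q)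
    (hQF : ∀ N ∈ F, 2 ≤ (Q ∩ N.1).card)
    (hno : ∀ P, IsMatching P → P.card < Q.card → ∃ N ∈ F, (P ∩ N.1).card ≤ 1) :
    F.card ≤ numPM (k - 2) := by
  rcases F.eq_empty_or_nonempty with rfl | ⟨M₀, hM₀⟩
  · simp
  have h2 : 2 ≤ Q.card := (hQF M₀ hM₀).trans (card_le_card inter_subset_left)
  have hQk := hQ.card_le
  obtain h2 | h3 : Q.card = 2 ∨ 3 ≤ Q.card := by omega
  · have hFQ : F ⊆ starAt F Q := fun N hN => by
      refine mem_starAt.2 ⟨hN, ?_⟩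
      rw [← inter_eq_left]
      exact eq_of_subset_of_card_le inter_subset_left (by rw [h2]; exact hQF N hN)
    have := (card_le_card hFQ).trans (card_starAt_le F Q)
    rwa [h2] at this
  have hpred : ∀ t, t < Q.card → ∀ P, P.card = t →
      (starAt F P).card ≤ (k - t) * (numPM (k - t - 1) - 1) + 1 := by
    rintro t ht P rfl
    exact card_starAt_le_sub_mul_pred_add_one hF fun h => hno P h ht
  by_cases hk4 : k ≤ 4
  · refine le_trans ?_ (numPM_pos _)
    refine card_le_one.2 fun M hM N hN => ?_
    obtain ⟨P, hPMN, hP⟩ := exists_subset_card_eq (hF M hM N hN)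
    have h := hpred 2 (by omega) P hP
    have h1 : (k - 2) * (numPM (k - 2 - 1) - 1) + 1 = 1 := by
      obtain rfl | rfl : k = 3 ∨ k = 4 := by omega
      · rfl
      · rfl
    rw [h1] at h
    exact card_le_one.1 h M (mem_starAt.2 ⟨hM, hPMN.trans inter_subset_left⟩) N
      (mem_starAt.2 ⟨hN, hPMN.trans inter_subset_right⟩)
  obtain h3 | h4 : Q.card = 3 ∨ 4 ≤ Q.card := by omega
  · exact card_le_of_transversal_three (by omega) hF (fun P h h' => hno P h (by omega)) hQ h3 hQF
  have hdesc : ∀ t v, 3 ≤ t → t ≤ Q.card → (∀ P, P.card = t → (starAt F P).card ≤ v) →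
      ∀ P, P.card = 3 → (starAt F P).card ≤ (k - 3).descFactorial (t - 3) * v := by
    intro t v ht htQ hv P hP
    have := card_starAt_le_descFactorial_mul hF (fun P h h' => hno P h (h'.trans_le htQ)) hv
      (t - 3) P (by omega)
    rwa [hP] at this
  have main : ∀ u, (∀ P', P'.card = 3 → (starAt F P').card ≤ u) →
      Q.card.choose 2 * ((k - 2) * u) ≤ 2 * numPM (k - 2) →
      (Q.card = 4 → 6 * ((k - 3) * u) + (k - 2) * u ≤ 2 * numPM (k - 2)) →
      F.card ≤ numPM (k - 2) := fun u =>
    card_le_of_four_le_transversal (by omega) hF (fun P h h' => hno P h (by omega)) hQ h4 hQF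
  by_cases hk7 : 7 ≤ k ∧ (k = 7 → Q.card < 7)
  · refine main _ (hdesc Q.card _ h3 le_rfl fun P hP => (card_starAt_le F P).trans (by rw [hP]))
      (choose_two_mul_le_two_mul_numPM hk7.1 h4 hQk hk7.2) fun h => ?_
    rw [h, show 4 - 3 = 1 by rfl, Nat.descFactorial_one]
    exact six_mul_add_le_two_mul_numPM (by omega)
  have hcases : k = 5 ∨ (k = 6 ∧ Q.card = 4) ∨ (k = 6 ∧ 5 ≤ Q.card) ∨ (k = 7 ∧ Q.card = 7) := by
    omega
  rcases hcases with rfl | ⟨rfl, hc⟩ | ⟨rfl, hc⟩ | ⟨rfl, hc⟩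
  · refine main _ (hdesc 3 _ le_rfl h3 (hpred 3 (by omega))) ?_ fun _ => by decide
    obtain h | h : Q.card = 4 ∨ Q.card = 5 := by omega
    · rw [h]; decide
    · rw [h]; decide
  · refine main _ (hdesc 3 _ le_rfl h3 (hpred 3 (by omega))) ?_ fun _ => by decide
    rw [hc]; decide
  · refine main _ (hdesc 4 _ (by omega) h4 (hpred 4 (by omega))) ?_ fun h => by omega
    obtain h | h : Q.card = 5 ∨ Q.card = 6 := by omega
    · rw [h]; decide
    · rw [h]; decide
  · refine main _ (hdesc 5 _ (by omega) (by omega) (hpred 5 (by omega))) ?_ fun h => by omega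
    rw [hc]; decide

theorem card_le_numPM {k : ℕ} (hk : 3 ≤ k) {F : Finset (PM (2 * k))}
    (hF : ∀ M ∈ F, ∀ N ∈ F, 2 ≤ (M.1 ∩ N.1).card) : F.card ≤ numPM (k - 2) := by
  rcases F.eq_empty_or_nonempty with rfl | ⟨M₀, hM₀⟩
  · simp
  classical
  obtain ⟨Q, hQ, hmin⟩ := exists_min_image
    (univ.filter fun Q : Finset (Sym2 (Fin (2 * k))) =>
      IsMatching Q ∧ ∀ N ∈ F, 2 ≤ (Q ∩ N.1).card) card
    ⟨M₀.1, mem_filter.2 ⟨mem_univ _, M₀.2.isMatching, hF M₀ hM₀⟩⟩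
  obtain ⟨-, hQ, hQF⟩ := mem_filter.1 hQ
  refine card_le_of_minimal_transversal hk hF hQ hQF fun P hP hPQ => ?_
  by_contra! h
  exact hPQ.not_ge (hmin P (mem_filter.2 ⟨mem_univ _, hP, fun N hN => h N hN⟩))

theorem exists_isMatching_card_eq {k m : ℕ} (hm : m ≤ k) :
    ∃ P : Finset (Sym2 (Fin (2 * k))), IsMatching P ∧ P.card = m := by
  have h : 0 < (starAt (univ : Finset (PM (2 * k))) ∅).card := by
    rw [card_starAt_univ k ∅ ⟨by simp, by simp⟩ (by simp)]
    exact numPM_pos k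
  obtain ⟨M, -⟩ := card_pos.1 h
  have hM := M.2.two_mul_card
  obtain ⟨P, hPM, hP⟩ := exists_subset_card_eq (show m ≤ M.1.card by omega)
  exact ⟨P, M.2.isMatching.mono hPM, hP⟩

end

/-- **EKR theorem for 2-intersecting perfect matchings.**  For every `k ≥ 3`, the maximum size
of a family of perfect matchings of `K_{2k}` any two of which share at least two edges is
`(2k-5)!!`: every such family has at most `(2k-5)!!` members, and some such family has exactly
`(2k-5)!!` members. -/
theorem ekr_two_intersecting_matchings (k : ℕ) (hk : 3 ≤ k) :
    (∀ F : Finset (PM (2 * k)),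
        (∀ P ∈ F, ∀ Q ∈ F, 2 ≤ (P.1 ∩ Q.1).card) →
        F.card ≤ Nat.doubleFactorial (2 * k - 5)) ∧
    (∃ F : Finset (PM (2 * k)),
        (∀ P ∈ F, ∀ Q ∈ F, 2 ≤ (P.1 ∩ Q.1).card) ∧
        F.card = Nat.doubleFactorial (2 * k - 5)) := by
  have hD : Nat.doubleFactorial (2 * k - 5) = numPM (k - 2) := by
    obtain ⟨m, rfl⟩ : ∃ m, k = m + 3 := ⟨k - 3, by omega⟩
    rw [show m + 3 - 2 = m + 1 by omega, numPM_succ]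
    congr 1
  rw [hD]
  refine ⟨fun F hF => card_le_numPM hk hF, ?_⟩
  obtain ⟨P, hP, hP2⟩ := exists_isMatching_card_eq (k := k) (m := 2) (by omega)
  refine ⟨starAt Finset.univ P, fun M hM N hN => ?_, card_starAt_univ _ P hP (by omega)⟩
  exact hP2.ge.trans <| Finset.card_le_card
    (Finset.subset_inter (mem_starAt.1 hM).2 (mem_starAt.1 hN).2)
end

section
/- Let k ≥ 3 and let S be a family of perfect matchings of K_{2k} any two of which have at least 2 edges in common, with |S| = (2k−5)!!. Then the characteristic vector χ_S ∈ ℝ^{PM(2k)} (indexed by all perfect matchings of K_{2k}, with entry 1 on members of S and 0 elsewhere) is a real linear combination of the vectors ν_{e₁,e₂}, taken over all pairs of disjoint edges e₁, e₂ of K_{2k}, where ν_{e₁,e₂} is the 0/1 vector indexed by perfect matchings whose entry at P is 1 exactly when P contains both e₁ and e₂. -/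
open Finset

/-- The set of vertices covered by a finite set of edges. -/
def coveredVerts {n : ℕ} (A : Finset (Sym2 (Fin n))) : Finset (Fin n) :=
  A.biUnion Sym2.toFinset

/-- The members of a family that contain a given set of edges. -/
def through {n : ℕ} (𝓢 : Finset (Finset (Sym2 (Fin n)))) (A : Finset (Sym2 (Fin n))) :
    Finset (Finset (Sym2 (Fin n))) :=
  𝓢.filter (A ⊆ ·)

/-- The number of perfect matchings of `K_{2k}` that contain `i` given disjoint edges. -/
def extCount (k i : ℕ) : ℕ := Nat.doubleFactorial (2 * (k - i) - 1)

section Basic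

variable {n k : ℕ}

lemma mem_coveredVerts {A : Finset (Sym2 (Fin n))} {v : Fin n} :
    v ∈ coveredVerts A ↔ ∃ e ∈ A, v ∈ e := by
  simp [coveredVerts]

lemma mem_through {𝓢 : Finset (Finset (Sym2 (Fin n)))} {A P : Finset (Sym2 (Fin n))} :
    P ∈ through 𝓢 A ↔ P ∈ 𝓢 ∧ A ⊆ P := by
  simp [through]

lemma through_mono {𝓢 𝓣 : Finset (Finset (Sym2 (Fin n)))} (h : 𝓢 ⊆ 𝓣)
    (A : Finset (Sym2 (Fin n))) : through 𝓢 A ⊆ through 𝓣 A :=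
  filter_subset_filter _ h

namespace IsPM

variable {P Q A : Finset (Sym2 (Fin n))}

lemma eq_of_mem (hP : IsPM P) {e f : Sym2 (Fin n)} {v : Fin n} (he : e ∈ P) (hf : f ∈ P)
    (hve : v ∈ e) (hvf : v ∈ f) : e = f :=
  (hP.2 v).unique ⟨he, hve⟩ ⟨hf, hvf⟩

lemma disjoint_toFinset (hP : IsPM P) {e f : Sym2 (Fin n)} (he : e ∈ P) (hf : f ∈ P)
    (hef : e ≠ f) : Disjoint e.toFinset f.toFinset := by
  rw [Finset.disjoint_left]
  intro v hv hv'
  exact hef (hP.eq_of_mem he hf (Sym2.mem_toFinset.1 hv) (Sym2.mem_toFinset.1 hv'))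

lemma disjoint_coveredVerts (hP : IsPM P) {e : Sym2 (Fin n)} (he : e ∈ P) (hA : A ⊆ P)
    (heA : e ∉ A) : Disjoint e.toFinset (coveredVerts A) := by
  rw [coveredVerts, disjoint_biUnion_right]
  intro f hf
  exact hP.disjoint_toFinset he (hA hf) (by rintro rfl; exact heA hf)

lemma card_toFinset (hP : IsPM P) {e : Sym2 (Fin n)} (he : e ∈ P) : #e.toFinset = 2 :=
  Sym2.card_toFinset_of_not_isDiag _ (hP.1 e he)

lemma card_coveredVerts (hP : IsPM P) (hA : A ⊆ P) : #(coveredVerts A) = 2 * #A := by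
  rw [coveredVerts, card_biUnion, sum_congr rfl fun e he => hP.card_toFinset (hA he)]
  · simp [mul_comm]
  · intro e he f hf hef
    exact hP.disjoint_toFinset (hA he) (hA hf) hef

lemma coveredVerts_eq_univ (hP : IsPM P) : coveredVerts P = univ := by
  ext v
  obtain ⟨e, he, -⟩ := hP.2 v
  simpa using mem_coveredVerts.2 ⟨e, he⟩

lemma card_eq {P : Finset (Sym2 (Fin (2 * k)))} (hP : IsPM P) : #P = k := by
  have h := hP.card_coveredVerts subset_rfl
  rw [hP.coveredVerts_eq_univ, card_univ, Fintype.card_fin] at h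
  omega

/-- If every vertex of `W` lies on an edge of the perfect matching `R` outside `U`, then `U`
is correspondingly small. -/
lemma card_add_two_mul_card_le {R U : Finset (Sym2 (Fin (2 * k)))} (hR : IsPM R) (hU : U ⊆ R)
    {W : Finset (Fin (2 * k))} (hW : ∀ v ∈ W, ∀ e ∈ R, v ∈ e → e ∉ U) :
    #W + 2 * #U ≤ 2 * k := by
  have hd : Disjoint W (coveredVerts U) := by
    rw [Finset.disjoint_left]
    intro v hv hv'
    obtain ⟨e, he, hve⟩ := mem_coveredVerts.1 hv'
    exact hW v hv e (hU he) hve he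
  rw [← hR.card_coveredVerts hU, ← card_union_of_disjoint hd]
  simpa using card_le_univ (W ∪ coveredVerts U)

end IsPM

/-- Bounding a family by the sizes of its subfamilies through each member of `𝓓`, when every
member of the family contains a member of `𝓓`. -/
lemma card_le_card_mul_of_forall_exists_subset {𝓕 𝓓 : Finset (Finset (Sym2 (Fin n)))} {B : ℕ}
    (h : ∀ P ∈ 𝓕, ∃ D ∈ 𝓓, D ⊆ P) (hB : ∀ D ∈ 𝓓, #(through 𝓕 D) ≤ B) :
    #𝓕 ≤ #𝓓 * B := by
  refine (card_le_card ?_).trans (card_biUnion_le_card_mul 𝓓 (through 𝓕) B hB)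
  intro P hP
  obtain ⟨D, hD, hDP⟩ := h P hP
  exact mem_biUnion.2 ⟨D, hD, mem_through.2 ⟨hP, hDP⟩⟩

lemma extCount_of_lt {i : ℕ} (h : i < k) :
    extCount k i = (2 * (k - i) - 1) * extCount k (i + 1) := by
  obtain ⟨m, rfl⟩ := Nat.exists_eq_add_of_lt h
  rcases m with _ | m
  · simp [extCount]
  · have h1 : 2 * (i + (m + 1) + 1 - i) - 1 = (2 * m + 1) + 2 := by omega
    have h2 : 2 * (i + (m + 1) + 1 - (i + 1)) - 1 = 2 * m + 1 := by omega
    rw [extCount, extCount, h1, h2, Nat.doubleFactorial_add_two]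

lemma extCount_of_le_add_one {i : ℕ} (h : k ≤ i + 1) : extCount k i = 1 := by
  rcases Nat.lt_or_ge i k with h' | h'
  · obtain rfl : k = i + 1 := by omega
    simp [extCount]
  · simp [extCount, Nat.sub_eq_zero_of_le h']

lemma extCount_pos (k i : ℕ) : 0 < extCount k i := Nat.doubleFactorial_pos _

/-- A set of `i` edges lies in at most `(2(k-i)-1)!!` perfect matchings of `K_{2k}`. -/
lemma card_through_le {𝓢 : Finset (Finset (Sym2 (Fin (2 * k))))} (h𝓢 : ∀ P ∈ 𝓢, IsPM P)
    (A : Finset (Sym2 (Fin (2 * k)))) : #(through 𝓢 A) ≤ extCount k #A := by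
  obtain ⟨d, hd⟩ : ∃ d, k - #A = d := ⟨_, rfl⟩
  induction d generalizing A with
  | zero =>
    refine (card_le_one.2 fun P hP Q hQ => ?_).trans (extCount_pos _ _)
    rw [mem_through] at hP hQ
    have hP' := (h𝓢 P hP.1).card_eq
    have hQ' := (h𝓢 Q hQ.1).card_eq
    rw [← eq_of_subset_of_card_le hP.2 (by omega), ← eq_of_subset_of_card_le hQ.2 (by omega)]
  | succ d ih =>
    rcases (through 𝓢 A).eq_empty_or_nonempty with h0 | ⟨P₀, hP₀⟩
    · simp [h0]
    rw [mem_through] at hP₀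
    have hV := (h𝓢 P₀ hP₀.1).card_coveredVerts hP₀.2
    obtain ⟨v, hv⟩ : ∃ v, v ∉ coveredVerts A := by
      by_contra! h
      have : coveredVerts A = univ := by ext; simp [h]
      rw [this, card_univ, Fintype.card_fin] at hV
      omega
    rw [extCount_of_lt (by omega)]
    let X := (insert v (coveredVerts A))ᶜ
    have hX : #X = 2 * (k - #A) - 1 := by
      rw [card_compl, card_insert_of_notMem hv, hV, Fintype.card_fin]
      omega
    rw [← hX]
    refine (card_le_card_mul_of_forall_exists_subset (𝓓 := X.image fun w => insert s(v, w) A)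
      (B := extCount k (#A + 1)) ?_ ?_).trans (Nat.mul_le_mul_right _ card_image_le)
    · intro P hP
      rw [mem_through] at hP
      have hPM := h𝓢 P hP.1
      obtain ⟨e, ⟨heP, hve⟩, -⟩ := hPM.2 v
      have hdisj := hPM.disjoint_coveredVerts heP hP.2
        fun heA => hv (mem_coveredVerts.2 ⟨e, heA, hve⟩)
      obtain ⟨w, rfl⟩ := hve
      refine ⟨_, mem_image_of_mem _ (?_ : w ∈ X), insert_subset heP hP.2⟩
      have hw : w ∉ coveredVerts A := Finset.disjoint_left.1 hdisj (by simp)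
      have hvw : w ≠ v := by
        rintro rfl
        exact hPM.1 _ heP (by simp)
      simp [X, hw, hvw]
    · intro D hD
      obtain ⟨w, hw, rfl⟩ := mem_image.1 hD
      have hnot : s(v, w) ∉ A := fun h => hv (mem_coveredVerts.2 ⟨_, h, by simp⟩)
      have hc : #(insert s(v, w) A) = #A + 1 := card_insert_of_notMem hnot
      rw [← hc]
      refine (card_le_card ?_).trans (ih _ (by omega))
      exact through_mono (filter_subset _ _) _

end Basic

section Arithmetic

lemma max_mul_three_pow_le (t : ℕ) :
    5 * (max (2 * (2 * (5 + (t + 1)) - 3)) ((5 + (t + 1)).choose 2) * 3 ^ (t + 1)) ≤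
      54 * 5 ^ (t + 1) := by
  have h : ∀ t : ℕ, 5 * ((2 * (2 * (5 + (t + 1)) - 3)) * 3 ^ (t + 1)) ≤ 54 * 5 ^ (t + 1) ∧
      5 * ((5 + (t + 1)).choose 2 * 3 ^ (t + 1)) ≤ 54 * 5 ^ (t + 1) := by
    intro t
    induction t with
    | zero => decide
    | succ t ih =>
      have h3 : 3 * (2 * (2 * (5 + (t + 1 + 1)) - 3)) ≤ 5 * (2 * (2 * (5 + (t + 1)) - 3)) := by
        omega
      have h4 : 3 * (5 + (t + 1 + 1)).choose 2 ≤ 5 * (5 + (t + 1)).choose 2 := by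
        have e1 := Nat.add_one_mul_choose_eq (5 + (t + 1)) 1
        have e2 := Nat.choose_succ_succ' (5 + (t + 1)) 1
        rw [Nat.choose_one_right] at e1 e2
        norm_num at e1 e2
        rw [show 5 + (t + 1 + 1) = 5 + (t + 1) + 1 by ring]
        nlinarith
      have h3' := Nat.mul_le_mul_right (3 ^ (t + 1)) h3
      have h4' := Nat.mul_le_mul_right (3 ^ (t + 1)) h4
      rw [pow_succ 3 (t + 1), pow_succ 5 (t + 1)]
      constructor <;> nlinarith [ih.1, ih.2]
  rcases max_cases (2 * (2 * (5 + (t + 1)) - 3)) ((5 + (t + 1)).choose 2) with h' | h'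
  · rw [h'.1]; exact (h t).1
  · rw [h'.1]; exact (h t).2

lemma choose_three_mul_three_pow_le (t : ℕ) :
    10 * ((5 + (t + 1)).choose 3 * 3 ^ (t + 1)) ≤ 126 * 5 ^ (t + 1) := by
  rcases t with _ | t
  · decide
  induction t with
  | zero => decide
  | succ t ih =>
    have h4 : 3 * (5 + (t + 1 + 1 + 1)).choose 3 ≤ 5 * (5 + (t + 1 + 1)).choose 3 := by
      have e1 := Nat.choose_succ_right_eq (5 + (t + 1 + 1)) 2
      have e2 := Nat.choose_succ_succ' (5 + (t + 1 + 1)) 2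
      rw [show 5 + (t + 1 + 1) - 2 = t + 5 by omega] at e1
      norm_num at e1 e2
      rw [show 5 + (t + 1 + 1 + 1) = 5 + (t + 1 + 1) + 1 by ring]
      nlinarith
    have h4' := Nat.mul_le_mul_right (3 ^ (t + 1 + 1)) h4
    rw [pow_succ 3 (t + 1 + 1), pow_succ 5 (t + 1 + 1)]
    nlinarith [ih]

lemma lt_of_trace_bounds {t m w c s x y : ℕ} (hct : 5 ^ t * c ≤ 3 ^ t * w) (hw : 0 < w)
    (hs : s ≤ x + y)
    (hx : 2 * x ≤ max (2 * (2 * (5 + t) - 3)) ((5 + t).choose 2) *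
      ((m + 3) * (m + 3) * ((m + 3) * c)))
    (hy : y ≤ (5 + t).choose 3 * ((m + 4) * ((m + 3) * c))) :
    s < (2 * (m + 3) + 3) * ((2 * (m + 3) + 1) * ((2 * m + 5) * w)) := by
  rcases t with _ | t
  · rw [show max (2 * (2 * (5 + 0) - 3)) (Nat.choose (5 + 0) 2) = 14 by decide] at hx
    rw [show Nat.choose (5 + 0) 3 = 10 by decide] at hy
    have hc : c ≤ w := by simpa using hct
    have h1 := Nat.mul_le_mul_left ((m + 3) * (m + 3) * (m + 3)) hc
    have h2 := Nat.mul_le_mul_left ((m + 4) * (m + 3)) hc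
    have h3 : 7 * ((m + 3) * (m + 3) * (m + 3)) + 10 * ((m + 4) * (m + 3)) <
        (2 * (m + 3) + 3) * ((2 * (m + 3) + 1) * (2 * m + 5)) := by
      nlinarith [Nat.zero_le (m * m * m), Nat.zero_le (m * m)]
    have h4 := Nat.mul_lt_mul_of_pos_right h3 hw
    linarith
  · set Z := max (2 * (2 * (5 + (t + 1)) - 3)) ((5 + (t + 1)).choose 2) with hZ
    set Y := (5 + (t + 1)).choose 3 with hY
    have hZ' := max_mul_three_pow_le t
    have hY' := choose_three_mul_three_pow_le t
    rw [← hZ] at hZ'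
    rw [← hY] at hY'
    set p := 3 ^ (t + 1)
    have hq : 0 < 5 ^ (t + 1) := by positivity
    set q := 5 ^ (t + 1)
    clear_value Z Y p q
    refine lt_of_mul_lt_mul_left (a := 10 * q) ?_ (Nat.zero_le _)
    have h1 : q * (2 * x) ≤ (Z * p) * ((m + 3) * (m + 3) * (m + 3)) * w := by
      calc q * (2 * x) ≤ q * (Z * ((m + 3) * (m + 3) * ((m + 3) * c))) :=
            Nat.mul_le_mul_left _ hx
        _ = Z * ((m + 3) * (m + 3) * (m + 3)) * (q * c) := by ring
        _ ≤ Z * ((m + 3) * (m + 3) * (m + 3)) * (p * w) := Nat.mul_le_mul_left _ hct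
        _ = _ := by ring
    have h2 : q * y ≤ (Y * p) * ((m + 4) * (m + 3)) * w := by
      calc q * y ≤ q * (Y * ((m + 4) * ((m + 3) * c))) := Nat.mul_le_mul_left _ hy
        _ = Y * ((m + 4) * (m + 3)) * (q * c) := by ring
        _ ≤ Y * ((m + 4) * (m + 3)) * (p * w) := Nat.mul_le_mul_left _ hct
        _ = _ := by ring
    have h3 : 5 * ((Z * p) * ((m + 3) * (m + 3) * (m + 3)) * w) ≤
        54 * q * ((m + 3) * (m + 3) * (m + 3)) * w := by
      have := Nat.mul_le_mul_right ((m + 3) * (m + 3) * (m + 3) * w) hZ'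
      linarith
    have h4 : 10 * ((Y * p) * ((m + 4) * (m + 3)) * w) ≤ 126 * q * ((m + 4) * (m + 3)) * w := by
      have := Nat.mul_le_mul_right ((m + 4) * (m + 3) * w) hY'
      linarith
    have h5 : 54 * ((m + 3) * (m + 3) * (m + 3)) + 126 * ((m + 4) * (m + 3)) <
        10 * ((2 * (m + 3) + 3) * ((2 * (m + 3) + 1) * (2 * m + 5))) := by
      nlinarith [Nat.zero_le (m * m * m), Nat.zero_le (m * m)]
    have h6 := Nat.mul_lt_mul_of_pos_right h5 (Nat.mul_pos hq hw)
    have h7 := Nat.mul_le_mul_left (10 * q) hs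
    linarith

end Arithmetic

/-- A family of perfect matchings of `K_{2k}` any two of which share at least two edges. -/
structure IsTwoIntersecting {k : ℕ} (𝓢 : Finset (Finset (Sym2 (Fin (2 * k))))) : Prop where
  isPM : ∀ P ∈ 𝓢, IsPM P
  inter : ∀ P ∈ 𝓢, ∀ Q ∈ 𝓢, 2 ≤ #(P ∩ Q)

/-- A set `T` of disjoint edges, of minimum size subject to lying in a member of `𝓢` and meeting
every member of `𝓢` in at least two edges. -/
structure IsMinCover {k : ℕ} (𝓢 : Finset (Finset (Sym2 (Fin (2 * k)))))
    (T : Finset (Sym2 (Fin (2 * k)))) : Prop where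
  exists_superset : ∃ P ∈ 𝓢, T ⊆ P
  two_le : ∀ R ∈ 𝓢, 2 ≤ #(T ∩ R)
  exists_of_card_lt : ∀ P ∈ 𝓢, ∀ A ⊆ P, #A < #T → ∃ R ∈ 𝓢, #(A ∩ R) ≤ 1

/-- The members of `𝓢` whose trace on `T` is `p`. -/
def withTrace {n : ℕ} (𝓢 : Finset (Finset (Sym2 (Fin n)))) (T p : Finset (Sym2 (Fin n))) :
    Finset (Finset (Sym2 (Fin n))) :=
  𝓢.filter (T ∩ · = p)

/-- The edges of `R` outside `T` that are disjoint from all edges of `A`. -/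
def usable {n : ℕ} (R A T : Finset (Sym2 (Fin n))) : Finset (Sym2 (Fin n)) :=
  R.filter fun e => e ∉ T ∧ Disjoint e.toFinset (coveredVerts A)

section Branching

variable {n k : ℕ}

lemma mem_withTrace {𝓢 : Finset (Finset (Sym2 (Fin n)))} {T p P : Finset (Sym2 (Fin n))} :
    P ∈ withTrace 𝓢 T p ↔ P ∈ 𝓢 ∧ T ∩ P = p := by
  simp [withTrace]

lemma mem_usable {R A T : Finset (Sym2 (Fin n))} {e : Sym2 (Fin n)} :
    e ∈ usable R A T ↔ e ∈ R ∧ e ∉ T ∧ Disjoint e.toFinset (coveredVerts A) := by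
  simp [usable]

lemma usable_subset (R A T : Finset (Sym2 (Fin n))) : usable R A T ⊆ R :=
  filter_subset _ _

lemma IsPM.mem_usable {P R A T : Finset (Sym2 (Fin n))} (hP : IsPM P) (hA : A ⊆ P)
    {e : Sym2 (Fin n)} (he : e ∈ P) (heR : e ∈ R) (heT : e ∉ T) (heA : e ∉ A) :
    e ∈ usable R A T :=
  _root_.mem_usable.2 ⟨heR, heT, hP.disjoint_coveredVerts he hA heA⟩

lemma IsPM.card_add_two_mul_card_usable_le {R A T : Finset (Sym2 (Fin (2 * k)))}
    (hR : IsPM R) {W : Finset (Fin (2 * k))}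
    (hW : ∀ v ∈ W, ∃ e ∈ R, v ∈ e ∧ (e ∈ T ∨ ∃ u ∈ e, u ∈ coveredVerts A)) :
    #W + 2 * #(usable R A T) ≤ 2 * k := by
  refine hR.card_add_two_mul_card_le (usable_subset R A T) fun v hv e he hve heU => ?_
  obtain ⟨f, hf, hvf, h⟩ := hW v hv
  obtain rfl := hR.eq_of_mem he hf hve hvf
  rw [_root_.mem_usable] at heU
  rcases h with h | ⟨u, hu, hu'⟩
  · exact heU.2.1 h
  · exact Finset.disjoint_left.1 heU.2.2 (Sym2.mem_toFinset.2 hu) hu'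

lemma IsPM.exists_edge_of_mem_coveredVerts {R A T : Finset (Sym2 (Fin n))}
    (hR : IsPM R) {v : Fin n} (hv : v ∈ coveredVerts A) :
    ∃ e ∈ R, v ∈ e ∧ (e ∈ T ∨ ∃ u ∈ e, u ∈ coveredVerts A) := by
  obtain ⟨e, ⟨he, hve⟩, -⟩ := hR.2 v
  exact ⟨e, he, hve, Or.inr ⟨v, hve, hv⟩⟩

lemma seven_le_card_union {p q r s : Sym2 (Fin n)} (hp : #p.toFinset = 2)
    (hq : #q.toFinset = 2) (hr : #r.toFinset = 2) (hs : #s.toFinset = 2)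
    (hpq : Disjoint p.toFinset q.toFinset) (hpr : Disjoint p.toFinset r.toFinset)
    (hps : Disjoint p.toFinset s.toFinset) (hqr : Disjoint q.toFinset r.toFinset)
    (hqs : Disjoint q.toFinset s.toFinset) (hrs : r ≠ s) :
    7 ≤ #((p.toFinset ∪ q.toFinset) ∪ (r.toFinset ∪ s.toFinset)) := by
  have h3 : 3 ≤ #(r.toFinset ∪ s.toFinset) := by
    by_contra! h
    have h1 := eq_of_subset_of_card_le (subset_union_left (s₁ := r.toFinset) (s₂ := s.toFinset))
      (by omega)
    have h2 := eq_of_subset_of_card_le (subset_union_right (s₁ := r.toFinset) (s₂ := s.toFinset))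
      (by omega)
    refine hrs (Sym2.ext fun x => ?_)
    rw [← Sym2.mem_toFinset, ← Sym2.mem_toFinset, h1, ← h2]
  rw [card_union_of_disjoint, card_union_of_disjoint hpq]
  · omega
  · rw [disjoint_union_left, disjoint_union_right, disjoint_union_right]
    exact ⟨⟨hpr, hps⟩, hqr, hqs⟩

/-- Branching over the elements of `U` when every member contains one of them. -/
lemma card_le_card_mul_of_hit {𝓕 : Finset (Finset (Sym2 (Fin n)))}
    {A U : Finset (Sym2 (Fin n))} {B : ℕ} (hA : ∀ P ∈ 𝓕, A ⊆ P) (h : ∀ P ∈ 𝓕, ∃ x ∈ U, x ∈ P)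
    (hB : ∀ x ∈ U, #(through 𝓕 (insert x A)) ≤ B) : #𝓕 ≤ #U * B := by
  refine (card_le_card_mul_of_forall_exists_subset (𝓓 := U.image fun x => insert x A)
    ?_ ?_).trans (Nat.mul_le_mul_right _ card_image_le)
  · intro P hP
    obtain ⟨x, hx, hxP⟩ := h P hP
    exact ⟨_, mem_image_of_mem _ hx, insert_subset hxP (hA P hP)⟩
  · intro D hD
    obtain ⟨x, hx, rfl⟩ := mem_image.1 hD
    exact hB x hx

/-- Branching over the pairs of elements of `U` when every member contains two of them. -/
lemma card_le_choose_mul_of_two_le {𝓕 : Finset (Finset (Sym2 (Fin n)))}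
    {A U : Finset (Sym2 (Fin n))} {B : ℕ} (hA : ∀ P ∈ 𝓕, A ⊆ P) (h : ∀ P ∈ 𝓕, 2 ≤ #(P ∩ U))
    (hB : ∀ D ⊆ U, #D = 2 → #(through 𝓕 (D ∪ A)) ≤ B) : #𝓕 ≤ (#U).choose 2 * B := by
  rw [← card_powersetCard]
  refine (card_le_card_mul_of_forall_exists_subset
    (𝓓 := (powersetCard 2 U).image fun D => D ∪ A) ?_ ?_).trans
      (Nat.mul_le_mul_right _ card_image_le)
  · intro P hP
    obtain ⟨D, hD, hD2⟩ := exists_subset_card_eq (h P hP)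
    refine ⟨_, mem_image_of_mem _ (mem_powersetCard.2 ⟨hD.trans inter_subset_right, hD2⟩), ?_⟩
    exact union_subset (hD.trans inter_subset_left) (hA P hP)
  · intro D hD
    obtain ⟨D', hD', rfl⟩ := mem_image.1 hD
    rw [mem_powersetCard] at hD'
    exact hB D' hD'.1 hD'.2

namespace IsTwoIntersecting

variable {𝓢 : Finset (Finset (Sym2 (Fin (2 * k))))} {T p A P R : Finset (Sym2 (Fin (2 * k)))}

lemma exists_mem_usable (h𝓢 : IsTwoIntersecting 𝓢) (hP : P ∈ 𝓢) (hR : R ∈ 𝓢) (hA : A ⊆ P)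
    (hAR : #(A ∩ R) ≤ 1) : ∃ x ∈ usable R A ∅, x ∈ P := by
  obtain ⟨x, hx, hx'⟩ := exists_mem_notMem_of_card_lt_card
    (lt_of_le_of_lt hAR (h𝓢.inter P hP R hR))
  rw [mem_inter] at hx hx'
  exact ⟨x, (h𝓢.isPM P hP).mem_usable hA hx.1 hx.2 (notMem_empty _)
    fun h => hx' ⟨h, hx.2⟩, hx.1⟩

lemma card_usable_le (h𝓢 : IsTwoIntersecting 𝓢) (hP : P ∈ 𝓢) (hR : R ∈ 𝓢) (hA : A ⊆ P) :
    #(usable R A T) ≤ k - #A := by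
  have := (h𝓢.isPM R hR).card_add_two_mul_card_usable_le (T := T) (W := coveredVerts A)
    fun v hv => (h𝓢.isPM R hR).exists_edge_of_mem_coveredVerts hv
  rw [(h𝓢.isPM P hP).card_coveredVerts hA] at this
  omega

lemma notMem_of_mem_usable {e : Sym2 (Fin (2 * k))} (h𝓢 : IsTwoIntersecting 𝓢) (hR : R ∈ 𝓢)
    (he : e ∈ usable R A T) : e ∉ A := by
  intro heA
  rw [mem_usable] at he
  have h2 := (h𝓢.isPM R hR).card_toFinset he.1
  obtain ⟨v, hv⟩ := card_pos.1 (by omega : 0 < #e.toFinset)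
  exact Finset.disjoint_left.1 he.2.2 hv
    (mem_coveredVerts.2 ⟨e, heA, Sym2.mem_toFinset.1 hv⟩)

/-- One branching step for a set of edges which is not a cover. -/
lemma card_through_le_mul (h𝓢 : IsTwoIntersecting 𝓢) (hR : R ∈ 𝓢) (hAR : #(A ∩ R) ≤ 1) {B : ℕ}
    (hB : ∀ A', #A' = #A + 1 → #(through 𝓢 A') ≤ B) : #(through 𝓢 A) ≤ (k - #A) * B := by
  rcases (through 𝓢 A).eq_empty_or_nonempty with h0 | ⟨P₀, hP₀⟩
  · simp [h0]
  rw [mem_through] at hP₀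
  refine (card_le_card_mul_of_hit (A := A) (U := usable R A ∅) (B := B)
    (fun P hP => (mem_through.1 hP).2) (fun P hP => ?_) (fun x hx => ?_)).trans
    (Nat.mul_le_mul_right _ (h𝓢.card_usable_le hP₀.1 hR hP₀.2))
  · rw [mem_through] at hP
    exact h𝓢.exists_mem_usable hP.1 hR hP.2 hAR
  · refine (card_le_card (through_mono (filter_subset _ _) _)).trans (hB _ ?_)
    exact card_insert_of_notMem (h𝓢.notMem_of_mem_usable hR hx)

/-- A set of `k - 2` edges which is not a cover lies in at most one member. -/
lemma card_through_le_one (h𝓢 : IsTwoIntersecting 𝓢) (hR : R ∈ 𝓢) (hAR : #(A ∩ R) ≤ 1)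
    (hA : k ≤ #A + 2) : #(through 𝓢 A) ≤ 1 := by
  refine card_le_one.2 fun P hP Q hQ => ?_
  rw [mem_through] at hP hQ
  have hPM := h𝓢.isPM P hP.1
  obtain ⟨e, heU, heP⟩ := h𝓢.exists_mem_usable hP.1 hR hP.2 hAR
  obtain ⟨f, hfU, hfQ⟩ := h𝓢.exists_mem_usable hQ.1 hR hQ.2 hAR
  have heA := h𝓢.notMem_of_mem_usable hR heU
  have hfA := h𝓢.notMem_of_mem_usable hR hfU
  suffices hfP : f ∈ P by
    have h1 := (card_through_le h𝓢.isPM (insert f A)).trans_eq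
      (extCount_of_le_add_one (by rw [card_insert_of_notMem hfA]; omega))
    exact card_le_one.1 h1 P (mem_through.2 ⟨hP.1, insert_subset hfP hP.2⟩) Q
      (mem_through.2 ⟨hQ.1, insert_subset hfQ hQ.2⟩)
  by_contra hfP
  have hef : e ≠ f := by rintro rfl; exact hfP heP
  have hRM := h𝓢.isPM R hR
  rw [mem_usable] at heU hfU
  have key : ∀ v ∈ f, ∀ g ∈ P, v ∈ g → g ∉ insert e A := by
    intro v hv g hg hvg hgA
    rcases mem_insert.1 hgA with rfl | hgA
    · exact hef (hRM.eq_of_mem heU.1 hfU.1 hvg hv)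
    · exact Finset.disjoint_left.1 hfU.2.2 (Sym2.mem_toFinset.2 hv)
        (mem_coveredVerts.2 ⟨g, hgA, hvg⟩)
  have huniq : ∀ g ∈ P, g ∉ insert e A → ∀ g' ∈ P, g' ∉ insert e A → g = g' := by
    intro g hg hgA g' hg' hgA'
    by_contra hne
    have hsub : insert g (insert g' (insert e A)) ⊆ P :=
      insert_subset hg (insert_subset hg' (insert_subset heP hP.2))
    have := card_le_card hsub
    rw [card_insert_of_notMem (by simpa [hne] using hgA),
      card_insert_of_notMem hgA', card_insert_of_notMem heA, hPM.card_eq] at this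
    omega
  induction f with
  | _ v w =>
    have hvw : v ≠ w := by simpa using hRM.1 _ hfU.1
    obtain ⟨g, ⟨hg, hvg⟩, -⟩ := hPM.2 v
    obtain ⟨g', ⟨hg', hwg'⟩, -⟩ := hPM.2 w
    obtain rfl := huniq g hg (key v (by simp) g hg hvg) g' hg' (key w (by simp) g' hg' hwg')
    exact hfP ((Sym2.mem_and_mem_iff hvw).1 ⟨hvg, hwg'⟩ ▸ hg)

end IsTwoIntersecting

namespace IsMinCover

variable {𝓢 : Finset (Finset (Sym2 (Fin (2 * k))))} {T p A P R : Finset (Sym2 (Fin (2 * k)))}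

lemma subset_of_mem_withTrace (hP : P ∈ withTrace 𝓢 T p) : p ⊆ P := by
  rw [mem_withTrace] at hP
  rw [← hP.2]
  exact inter_subset_right

lemma card_sdiff_of_mem_withTrace (h𝓢 : IsTwoIntersecting 𝓢) (hP : P ∈ withTrace 𝓢 T p)
    (hR : R ∈ 𝓢) : 2 ≤ #((P ∩ R) \ T) + #(p ∩ R) := by
  rw [mem_withTrace] at hP
  have h1 := h𝓢.inter P hP.1 R hR
  have h2 := card_sdiff_add_card_inter (P ∩ R) T
  have h3 : P ∩ R ∩ T = p ∩ R := by
    rw [← hP.2]; ext; simp; tauto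
  rw [h3] at h2
  omega

lemma exists_mem_inter_sdiff (h𝓢 : IsTwoIntersecting 𝓢) (hP : P ∈ withTrace 𝓢 T p)
    (hR : R ∈ 𝓢) (hpR : #(p ∩ R) ≤ 1) : ∃ x ∈ P, x ∈ R ∧ x ∉ T := by
  have := card_sdiff_of_mem_withTrace h𝓢 hP hR
  obtain ⟨x, hx⟩ := card_pos.1 (by omega : 0 < #((P ∩ R) \ T))
  simp only [mem_sdiff, mem_inter] at hx
  exact ⟨x, hx.1.1, hx.1.2, hx.2⟩

/-- A member of `𝓢` disjoint from `p` leaves at most `k - 4` usable edges. -/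
lemma card_usable_add_four_le_of_disjoint (h𝓢 : IsTwoIntersecting 𝓢) (hT : IsMinCover 𝓢 T)
    (hp : p ⊆ T) (hp2 : #p = 2) (hR : R ∈ 𝓢) (hpR : Disjoint p R) :
    #(usable R p T) + 4 ≤ k := by
  obtain ⟨P₀, hP₀, hTP₀⟩ := hT.exists_superset
  have hRM := h𝓢.isPM R hR
  have h1 := (h𝓢.isPM P₀ hP₀).card_coveredVerts (A := p ∪ (T ∩ R))
    ((union_subset hp inter_subset_left).trans hTP₀)
  rw [card_union_of_disjoint (hpR.mono_right inter_subset_right)] at h1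
  have h2 := hT.two_le R hR
  have h3 := hRM.card_add_two_mul_card_usable_le (A := p) (T := T)
    (W := coveredVerts (p ∪ (T ∩ R))) fun v hv => by
      obtain ⟨e, he, hve⟩ := mem_coveredVerts.1 hv
      rcases mem_union.1 he with he | he
      · exact hRM.exists_edge_of_mem_coveredVerts (mem_coveredVerts.2 ⟨e, he, hve⟩)
      · rw [mem_inter] at he
        exact ⟨e, he.2, hve, Or.inl he.1⟩
  omega

/-- A member of `𝓢` containing one of the two edges of `p` leaves at most `k - 4` usable
edges. -/
lemma card_usable_add_four_le_of_card_inter_eq_one (h𝓢 : IsTwoIntersecting 𝓢)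
    (hT : IsMinCover 𝓢 T) (hp : p ⊆ T) (hp2 : #p = 2) (hR : R ∈ 𝓢) (hpR : #(p ∩ R) = 1) :
    #(usable R p T) + 4 ≤ k := by
  obtain ⟨P₀, hP₀, hTP₀⟩ := hT.exists_superset
  have hRM := h𝓢.isPM R hR
  have hPM := h𝓢.isPM P₀ hP₀
  obtain ⟨a, ha⟩ := card_eq_one.1 hpR
  have ha' : a ∈ p ∩ R := by simp [ha]
  rw [mem_inter] at ha'
  obtain ⟨b, hb, hba⟩ := exists_mem_ne (by omega : 1 < #p) a
  have hbR : b ∉ R := fun h => hba (by simpa [ha] using mem_inter.2 ⟨hb, h⟩)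
  obtain ⟨c, hc, hca⟩ := exists_mem_ne (hT.two_le R hR) a
  rw [mem_inter] at hc
  have hcb : c ≠ b := by rintro rfl; exact hbR hc.2
  have hb2 := hPM.card_toFinset (hTP₀ (hp hb))
  obtain ⟨v, hv⟩ := card_pos.1 (by omega : 0 < #b.toFinset)
  rw [Sym2.mem_toFinset] at hv
  obtain ⟨d, ⟨hd, hvd⟩, -⟩ := hRM.2 v
  have hdb : b ≠ d := by rintro rfl; exact hbR hd
  have hda : a ≠ d := by
    rintro rfl
    exact hba (hPM.eq_of_mem (hTP₀ (hp hb)) (hTP₀ (hp ha'.1)) hv hvd)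
  have hdc : c ≠ d := by
    rintro rfl
    exact hcb (hPM.eq_of_mem (hTP₀ hc.1) (hTP₀ (hp hb)) hvd hv)
  have h7 := seven_le_card_union (hPM.card_toFinset (hTP₀ (hp ha'.1)))
    (hPM.card_toFinset (hTP₀ hc.1)) hb2 (hRM.card_toFinset hd)
    (hPM.disjoint_toFinset (hTP₀ (hp ha'.1)) (hTP₀ hc.1) hca.symm)
    (hPM.disjoint_toFinset (hTP₀ (hp ha'.1)) (hTP₀ (hp hb)) hba.symm)
    (hRM.disjoint_toFinset ha'.2 hd hda)
    (hPM.disjoint_toFinset (hTP₀ hc.1) (hTP₀ (hp hb)) hcb)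
    (hRM.disjoint_toFinset hc.2 hd hdc) hdb
  have hvp : v ∈ coveredVerts p := mem_coveredVerts.2 ⟨b, hb, hv⟩
  have h3 := hRM.card_add_two_mul_card_usable_le (A := p) (T := T)
    (W := (a.toFinset ∪ c.toFinset) ∪ (b.toFinset ∪ d.toFinset)) fun u hu => by
      simp only [mem_union, Sym2.mem_toFinset] at hu
      rcases hu with (hu | hu) | (hu | hu)
      · exact ⟨a, ha'.2, hu, Or.inl (hp ha'.1)⟩
      · exact ⟨c, hc.2, hu, Or.inl hc.1⟩
      · exact hRM.exists_edge_of_mem_coveredVerts (mem_coveredVerts.2 ⟨b, hb, hu⟩)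
      · exact ⟨d, hd, hu, Or.inr ⟨v, hvd, hvp⟩⟩
  omega

/-- The same bound after adding to `p` an edge `x` outside `T`. -/
lemma card_usable_insert_add_four_le (h𝓢 : IsTwoIntersecting 𝓢) (hT : IsMinCover 𝓢 T)
    (hp : p ⊆ T) (hp2 : #p = 2) {x : Sym2 (Fin (2 * k))} (hx : x ∉ T) (hP : P ∈ 𝓢)
    (hpP : insert x p ⊆ P) (hR : R ∈ 𝓢) (hpR : #(insert x p ∩ R) ≤ 1) :
    #(usable R (insert x p) T) + 4 ≤ k := by
  obtain ⟨P₀, hP₀, hTP₀⟩ := hT.exists_superset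
  have hRM := h𝓢.isPM R hR
  have hPM₀ := h𝓢.isPM P₀ hP₀
  have hPM := h𝓢.isPM P hP
  obtain ⟨c, hc, hc'⟩ := exists_mem_notMem_of_card_lt_card
    (lt_of_le_of_lt hpR (hT.two_le R hR))
  rw [mem_inter] at hc
  have hcp : c ∉ insert x p := fun h => hc' (mem_inter.2 ⟨h, hc.2⟩)
  rw [mem_insert, not_or] at hcp
  obtain ⟨a, b, hab, rfl⟩ := card_eq_two.1 hp2
  have ha : a ∈ T := hp (by simp)
  have hb : b ∈ T := hp (by simp)
  have haP : a ∈ P := hpP (by simp)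
  have hbP : b ∈ P := hpP (by simp)
  have hxP : x ∈ P := hpP (by simp)
  have hac : a ≠ c := by rintro rfl; simp at hcp
  have hbc : b ≠ c := by rintro rfl; simp at hcp
  have hax : a ≠ x := by rintro rfl; exact hx ha
  have hbx : b ≠ x := by rintro rfl; exact hx hb
  have h7 := seven_le_card_union (hPM.card_toFinset haP) (hPM.card_toFinset hbP)
    (hPM.card_toFinset hxP) (hRM.card_toFinset hc.2) (hPM.disjoint_toFinset haP hbP hab)
    (hPM.disjoint_toFinset haP hxP hax) (hPM₀.disjoint_toFinset (hTP₀ ha) (hTP₀ hc.1) hac)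
    (hPM.disjoint_toFinset hbP hxP hbx) (hPM₀.disjoint_toFinset (hTP₀ hb) (hTP₀ hc.1) hbc)
    (Ne.symm hcp.1)
  have h3 := hRM.card_add_two_mul_card_usable_le (A := insert x {a, b}) (T := T)
    (W := (a.toFinset ∪ b.toFinset) ∪ (x.toFinset ∪ c.toFinset)) fun u hu => by
      simp only [mem_union, Sym2.mem_toFinset] at hu
      rcases hu with (hu | hu) | (hu | hu)
      · exact hRM.exists_edge_of_mem_coveredVerts (mem_coveredVerts.2 ⟨a, by simp, hu⟩)
      · exact hRM.exists_edge_of_mem_coveredVerts (mem_coveredVerts.2 ⟨b, by simp, hu⟩)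
      · exact hRM.exists_edge_of_mem_coveredVerts (mem_coveredVerts.2 ⟨x, by simp, hu⟩)
      · exact ⟨c, hc.2, hu, Or.inl hc.1⟩
  omega

lemma card_withTrace_le_of_disjoint (h𝓢 : IsTwoIntersecting 𝓢) (hT : IsMinCover 𝓢 T)
    (hp : p ⊆ T) (hp2 : #p = 2) (hR : R ∈ 𝓢) (hpR : Disjoint p R) {B : ℕ}
    (hB : ∀ A, #A = 4 → #(through 𝓢 A) ≤ B) :
    #(withTrace 𝓢 T p) ≤ (k - 4).choose 2 * B := by
  have hU := card_usable_add_four_le_of_disjoint h𝓢 hT hp hp2 hR hpR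
  refine (card_le_choose_mul_of_two_le (A := p) (U := usable R p T) (B := B)
    (fun P hP => subset_of_mem_withTrace hP) (fun P hP => ?_) (fun D hD hD2 => ?_)).trans
    (Nat.mul_le_mul_right _ (Nat.choose_le_choose 2 (by omega)))
  · have h := card_sdiff_of_mem_withTrace h𝓢 hP hR
    rw [disjoint_iff_inter_eq_empty.1 hpR, card_empty] at h
    refine h.trans (card_le_card fun e he => ?_)
    simp only [mem_sdiff, mem_inter] at he
    have hP' := (mem_withTrace.1 hP).1
    exact mem_inter.2 ⟨he.1.1, (h𝓢.isPM P hP').mem_usable (subset_of_mem_withTrace hP) he.1.1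
      he.1.2 he.2 fun h => he.2 (hp h)⟩
  · refine (card_le_card (through_mono (filter_subset _ _) _)).trans (hB _ ?_)
    rw [card_union_of_disjoint, hD2, hp2]
    rw [Finset.disjoint_left]
    intro e he
    exact h𝓢.notMem_of_mem_usable hR (hD he)

lemma card_withTrace_le_of_card_inter_eq_one (h𝓢 : IsTwoIntersecting 𝓢) (hT : IsMinCover 𝓢 T)
    (hp : p ⊆ T) (hp2 : #p = 2) (hR : R ∈ 𝓢) (hpR : #(p ∩ R) = 1) {B : ℕ}
    (hB : ∀ x ∉ T, #(through (withTrace 𝓢 T p) (insert x p)) ≤ B) :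
    #(withTrace 𝓢 T p) ≤ (k - 4) * B := by
  have hU := card_usable_add_four_le_of_card_inter_eq_one h𝓢 hT hp hp2 hR hpR
  refine (card_le_card_mul_of_hit (A := p) (U := usable R p T) (B := B)
    (fun P hP => subset_of_mem_withTrace hP) (fun P hP => ?_) (fun x hx => ?_)).trans
    (Nat.mul_le_mul_right _ (by omega))
  · obtain ⟨x, hxP, hxR, hxT⟩ := exists_mem_inter_sdiff h𝓢 hP hR hpR.le
    have hP' := (mem_withTrace.1 hP).1
    exact ⟨x, (h𝓢.isPM P hP').mem_usable (subset_of_mem_withTrace hP) hxP hxR hxT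
      fun h => hxT (hp h), hxP⟩
  · exact hB x (mem_usable.1 hx).2.1

lemma card_through_withTrace_insert_le (h𝓢 : IsTwoIntersecting 𝓢) (hT : IsMinCover 𝓢 T)
    (hT4 : 4 ≤ #T) (hp : p ⊆ T) (hp2 : #p = 2) {x : Sym2 (Fin (2 * k))} (hx : x ∉ T) {B : ℕ}
    (hB : ∀ A, #A = 4 → #(through 𝓢 A) ≤ B) :
    #(through (withTrace 𝓢 T p) (insert x p)) ≤ (k - 4) * B := by
  rcases (through (withTrace 𝓢 T p) (insert x p)).eq_empty_or_nonempty with h0 | ⟨P₀, hP₀⟩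
  · simp [h0]
  rw [mem_through, mem_withTrace] at hP₀
  have hxp : #(insert x p) = 3 := by
    rw [card_insert_of_notMem fun h => hx (hp h), hp2]
  obtain ⟨R, hR, hpR⟩ := hT.exists_of_card_lt P₀ hP₀.1.1 _ hP₀.2 (by omega)
  have hU := card_usable_insert_add_four_le h𝓢 hT hp hp2 hx hP₀.1.1 hP₀.2 hR hpR
  refine (card_le_card_mul_of_hit (A := insert x p) (U := usable R (insert x p) T) (B := B)
    (fun P hP => (mem_through.1 hP).2) (fun P hP => ?_) (fun y hy => ?_)).trans
    (Nat.mul_le_mul_right _ (by omega))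
  · rw [mem_through] at hP
    have hP' := mem_withTrace.1 hP.1
    have hPM := h𝓢.isPM P hP'.1
    obtain ⟨y, hy, hy'⟩ := exists_mem_notMem_of_card_lt_card
      (lt_of_le_of_lt hpR (h𝓢.inter P hP'.1 R hR))
    rw [mem_inter] at hy
    have hyp : y ∉ insert x p := fun h => hy' (mem_inter.2 ⟨h, hy.2⟩)
    have hyT : y ∉ T := by
      intro h
      apply hyp
      rw [← hP'.2]
      exact mem_insert_of_mem (mem_inter.2 ⟨h, hy.1⟩)
    exact ⟨y, hPM.mem_usable hP.2 hy.1 hy.2 hyT hyp, hy.1⟩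
  · refine (card_le_card ?_).trans (hB (insert y (insert x p)) ?_)
    · exact through_mono ((filter_subset _ _).trans (filter_subset _ _)) _
    · rw [card_insert_of_notMem (h𝓢.notMem_of_mem_usable hR hy), hxp]

lemma card_le_sum_add (hT : IsMinCover 𝓢 T) :
    #𝓢 ≤ ∑ p ∈ powersetCard 2 T, #(withTrace 𝓢 T p) + #(𝓢.filter (fun P => 3 ≤ #(T ∩ P))) := by
  have h : 𝓢 ⊆ (powersetCard 2 T).biUnion (withTrace 𝓢 T) ∪ 𝓢.filter (fun P => 3 ≤ #(T ∩ P)) := by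
    intro P hP
    have h2 := hT.two_le P hP
    rcases h2.eq_or_lt with h | h
    · refine mem_union_left _ (mem_biUnion.2 ⟨T ∩ P, ?_, mem_withTrace.2 ⟨hP, rfl⟩⟩)
      exact mem_powersetCard.2 ⟨inter_subset_left, h.symm⟩
    · exact mem_union_right _ (mem_filter.2 ⟨hP, h⟩)
  exact (card_le_card h).trans ((card_union_le _ _).trans (Nat.add_le_add_right card_biUnion_le _))

lemma card_filter_three_le {B : ℕ} (hB : ∀ A, #A = 3 → #(through 𝓢 A) ≤ B) :
    #(𝓢.filter (fun P => 3 ≤ #(T ∩ P))) ≤ (#T).choose 3 * B := by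
  rw [← card_powersetCard]
  refine card_le_card_mul_of_forall_exists_subset (fun P hP => ?_) (fun D hD => ?_)
  · obtain ⟨D, hD, hD3⟩ := exists_subset_card_eq (mem_filter.1 hP).2
    exact ⟨D, mem_powersetCard.2 ⟨hD.trans inter_subset_left, hD3⟩, hD.trans inter_subset_right⟩
  · exact (card_le_card (through_mono (filter_subset _ _) _)).trans
      (hB D (mem_powersetCard.1 hD).2)

lemma card_le (h𝓢 : IsTwoIntersecting 𝓢) (hT : IsMinCover 𝓢 T) : #T ≤ k := by
  obtain ⟨P, hP, hTP⟩ := hT.exists_superset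
  exact (card_le_card hTP).trans_eq (h𝓢.isPM P hP).card_eq

lemma card_through_le_mul (h𝓢 : IsTwoIntersecting 𝓢) (hT : IsMinCover 𝓢 T) (hA : #A < #T)
    {B : ℕ} (hB : ∀ A', #A' = #A + 1 → #(through 𝓢 A') ≤ B) :
    #(through 𝓢 A) ≤ (k - #A) * B := by
  rcases (through 𝓢 A).eq_empty_or_nonempty with h0 | ⟨P₀, hP₀⟩
  · simp [h0]
  rw [mem_through] at hP₀
  obtain ⟨R, hR, hAR⟩ := hT.exists_of_card_lt P₀ hP₀.1 A hP₀.2 hA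
  exact h𝓢.card_through_le_mul hR hAR hB

lemma card_through_le_one (h𝓢 : IsTwoIntersecting 𝓢) (hT : IsMinCover 𝓢 T) (hA : #A < #T)
    (hk : k ≤ #A + 2) : #(through 𝓢 A) ≤ 1 := by
  rcases (through 𝓢 A).eq_empty_or_nonempty with h0 | ⟨P₀, hP₀⟩
  · simp [h0]
  rw [mem_through] at hP₀
  obtain ⟨R, hR, hAR⟩ := hT.exists_of_card_lt P₀ hP₀.1 A hP₀.2 hA
  exact h𝓢.card_through_le_one hR hAR hk

lemma card_filter_three_le_one (h𝓢 : IsTwoIntersecting 𝓢) (hT : IsMinCover 𝓢 T) (hTk : #T = k)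
    (hk : k ≤ 5) : #(𝓢.filter (fun P => 3 ≤ #(T ∩ P))) ≤ 1 := by
  obtain ⟨P, hP, hTP⟩ := hT.exists_superset
  have hTP' : T = P := eq_of_subset_of_card_le hTP (by rw [(h𝓢.isPM P hP).card_eq, hTk])
  have h : ∀ Q ∈ 𝓢.filter (fun P => 3 ≤ #(T ∩ P)), Q = T := by
    intro Q hQ
    rw [mem_filter] at hQ
    rcases lt_or_ge #(T ∩ Q) #T with hlt | hge
    · have h1 := hT.card_through_le_one h𝓢 hlt (by omega)
      rw [card_le_one] at h1
      exact h1 Q (mem_through.2 ⟨hQ.1, inter_subset_right⟩) T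
        (mem_through.2 ⟨hTP' ▸ hP, inter_subset_left⟩)
    · have h1 := eq_of_subset_of_card_le inter_subset_left hge
      have h2 : T ⊆ Q := inter_eq_left.1 h1
      exact (eq_of_subset_of_card_le h2 (by rw [(h𝓢.isPM Q hQ.1).card_eq, hTk])).symm
  exact card_le_one.2 fun Q hQ Q' hQ' => (h Q hQ).trans (h Q' hQ').symm

lemma two_mul_choose_two_le (n : ℕ) : 2 * n.choose 2 ≤ n * n := by
  rw [Nat.choose_two_right]
  exact (Nat.mul_div_le _ _).trans (Nat.mul_le_mul_left _ (Nat.sub_le _ _))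

lemma two_mul_card_withTrace_le_of_disjoint (h𝓢 : IsTwoIntersecting 𝓢) (hT : IsMinCover 𝓢 T)
    (hp : p ⊆ T) (hp2 : #p = 2) (hR : R ∈ 𝓢) (hpR : Disjoint p R) {B : ℕ}
    (hB : ∀ A, #A = 4 → #(through 𝓢 A) ≤ B) :
    2 * #(withTrace 𝓢 T p) ≤ (k - 4) * (k - 4) * B := by
  have h1 := card_withTrace_le_of_disjoint h𝓢 hT hp hp2 hR hpR hB
  have h2 := Nat.mul_le_mul_right B (two_mul_choose_two_le (k - 4))
  linarith

lemma card_withTrace_le (h𝓢 : IsTwoIntersecting 𝓢) (hT : IsMinCover 𝓢 T) (hT4 : 4 ≤ #T)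
    (hp : p ⊆ T) (hp2 : #p = 2) {B : ℕ} (hB : ∀ A, #A = 4 → #(through 𝓢 A) ≤ B) :
    #(withTrace 𝓢 T p) ≤ (k - 4) * (k - 4) * B := by
  rcases (withTrace 𝓢 T p).eq_empty_or_nonempty with h0 | ⟨P₀, hP₀⟩
  · simp [h0]
  obtain ⟨R, hR, hpR⟩ := hT.exists_of_card_lt P₀ (mem_withTrace.1 hP₀).1 p
    (subset_of_mem_withTrace hP₀) (by omega)
  rcases hpR.lt_or_eq with h | h
  · rw [Nat.lt_one_iff, card_eq_zero, ← disjoint_iff_inter_eq_empty] at h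
    have := hT.two_mul_card_withTrace_le_of_disjoint h𝓢 hp hp2 hR h hB
    omega
  · rw [mul_assoc]
    exact card_withTrace_le_of_card_inter_eq_one h𝓢 hT hp hp2 hR h
      fun x hx => card_through_withTrace_insert_le h𝓢 hT hT4 hp hp2 hx hB

lemma disjoint_of_mem_withTrace {q : Finset (Sym2 (Fin (2 * k)))} (hR : R ∈ withTrace 𝓢 T q)
    (hp : p ⊆ T) (hpq : Disjoint p q) : Disjoint p R := by
  rw [Finset.disjoint_left]
  intro e he heR
  refine Finset.disjoint_left.1 hpq he ?_
  rw [← (mem_withTrace.1 hR).2]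
  exact mem_inter.2 ⟨hp he, heR⟩

/-- For a cover of size four, complementary traces are balanced against each other. -/
lemma sum_card_withTrace_le_of_card_eq_four (h𝓢 : IsTwoIntersecting 𝓢) (hT : IsMinCover 𝓢 T)
    (hT4 : #T = 4) {B : ℕ} (hB : ∀ A, #A = 4 → #(through 𝓢 A) ≤ B) :
    ∑ p ∈ powersetCard 2 T, #(withTrace 𝓢 T p) ≤ 3 * ((k - 4) * (k - 4) * B) := by
  have hcompl : ∀ p ∈ powersetCard 2 T, T \ p ∈ powersetCard 2 T := by
    intro p hp
    rw [mem_powersetCard] at hp ⊢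
    exact ⟨sdiff_subset, by rw [card_sdiff_of_subset hp.1]; omega⟩
  have hsum : ∑ p ∈ powersetCard 2 T, #(withTrace 𝓢 T (T \ p)) =
      ∑ p ∈ powersetCard 2 T, #(withTrace 𝓢 T p) :=
    sum_nbij' (T \ ·) (T \ ·) hcompl hcompl
      (fun p hp => Finset.sdiff_sdiff_eq_self (mem_powersetCard.1 hp).1)
      (fun p hp => Finset.sdiff_sdiff_eq_self (mem_powersetCard.1 hp).1) (fun _ _ => rfl)
  have hle : ∑ p ∈ powersetCard 2 T, (#(withTrace 𝓢 T p) + #(withTrace 𝓢 T (T \ p))) ≤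
      #(powersetCard 2 T) • ((k - 4) * (k - 4) * B) := by
    refine sum_le_card_nsmul _ _ _ fun p hp => ?_
    have hq := mem_powersetCard.1 (hcompl p hp)
    rw [mem_powersetCard] at hp
    have h1 := hT.card_withTrace_le h𝓢 hT4.ge hp.1 hp.2 hB
    have h2 := hT.card_withTrace_le h𝓢 hT4.ge hq.1 hq.2 hB
    rcases (withTrace 𝓢 T p).eq_empty_or_nonempty with h0 | ⟨P, hP⟩
    · rw [h0, card_empty]; omega
    rcases (withTrace 𝓢 T (T \ p)).eq_empty_or_nonempty with h0' | ⟨Q, hQ⟩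
    · rw [h0', card_empty]; omega
    have h3 := hT.two_mul_card_withTrace_le_of_disjoint h𝓢 hp.1 hp.2 (mem_withTrace.1 hQ).1
      (disjoint_of_mem_withTrace hQ hp.1 disjoint_sdiff) hB
    have h4 := hT.two_mul_card_withTrace_le_of_disjoint h𝓢 hq.1 hq.2 (mem_withTrace.1 hP).1
      (disjoint_of_mem_withTrace hP hq.1 sdiff_disjoint) hB
    omega
  rw [sum_add_distrib, hsum, card_powersetCard, hT4, smul_eq_mul,
    show Nat.choose 4 2 = 6 from rfl] at hle
  omega

lemma two_mul_sum_card_withTrace_le (h𝓢 : IsTwoIntersecting 𝓢) (hT : IsMinCover 𝓢 T)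
    (hT4 : 4 ≤ #T) {B : ℕ} (hB : ∀ A, #A = 4 → #(through 𝓢 A) ≤ B) :
    2 * ∑ p ∈ powersetCard 2 T, #(withTrace 𝓢 T p) ≤
      max (2 * (2 * #T - 3)) ((#T).choose 2) * ((k - 4) * (k - 4) * B) := by
  by_cases hall : ∀ p ∈ powersetCard 2 T, ∃ R ∈ 𝓢, Disjoint p R
  · refine le_trans ?_ (Nat.mul_le_mul_right _ (le_max_right _ _))
    rw [mul_sum, ← card_powersetCard, ← smul_eq_mul (#_)]
    refine sum_le_card_nsmul _ _ _ fun p hp => ?_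
    obtain ⟨R, hR, hpR⟩ := hall p hp
    rw [mem_powersetCard] at hp
    exact hT.two_mul_card_withTrace_le_of_disjoint h𝓢 hp.1 hp.2 hR hpR hB
  · push Not at hall
    obtain ⟨p, hp, hpR⟩ := hall
    rw [mem_powersetCard] at hp
    refine le_trans ?_ (Nat.mul_le_mul_right _ (le_max_left _ _))
    rw [mul_assoc]
    refine Nat.mul_le_mul_left 2 ?_
    have hsub : powersetCard 2 (T \ p) ⊆ powersetCard 2 T := powersetCard_mono sdiff_subset
    rw [← sum_sdiff hsub, sum_eq_zero (s := powersetCard 2 (T \ p)), add_zero]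
    · have hc : #(powersetCard 2 T \ powersetCard 2 (T \ p)) = 2 * #T - 3 := by
        rw [card_sdiff_of_subset hsub, card_powersetCard, card_powersetCard,
          card_sdiff_of_subset hp.1, hp.2]
        obtain ⟨m, hm⟩ := Nat.exists_eq_add_of_le hT4
        rw [hm, show 4 + m - 2 = m + 2 by omega, show 4 + m = m + 2 + 1 + 1 by omega,
          Nat.choose_succ_succ' (m + 2 + 1) 1, Nat.choose_succ_succ' (m + 2) 1,
          Nat.choose_one_right, Nat.choose_one_right]
        norm_num
        omega
      refine le_of_le_of_eq ?_ (congrArg (· * ((k - 4) * (k - 4) * B)) hc)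
      refine sum_le_card_nsmul _ _ _ fun q hq => ?_
      have hq' := mem_powersetCard.1 (mem_sdiff.1 hq).1
      exact hT.card_withTrace_le h𝓢 hT4 hq'.1 hq'.2 hB
    · intro q hq
      rw [card_eq_zero, eq_empty_iff_forall_notMem]
      intro R hR
      refine hpR R (mem_withTrace.1 hR).1 (disjoint_of_mem_withTrace hR hp.1 ?_)
      exact disjoint_sdiff.mono_right (mem_powersetCard.1 hq).1

lemma pow_mul_card_through_le (h𝓢 : IsTwoIntersecting 𝓢) (hT : IsMinCover 𝓢 T) {j d : ℕ}
    (hjd : j + d = min #T (k - 2)) (hk : 2 ≤ k) (A : Finset (Sym2 (Fin (2 * k))))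
    (hA : #A = j) : 5 ^ (#T - j) * #(through 𝓢 A) ≤ 3 ^ (#T - j) * extCount k j := by
  induction d generalizing j A with
  | zero =>
    rcases le_or_gt #T (k - 2) with h | h
    · have hj : j = #T := by omega
      rw [hj, Nat.sub_self, pow_zero, pow_zero, one_mul, one_mul, ← hj, ← hA]
      exact card_through_le h𝓢.isPM A
    · have hj : j = k - 2 := by omega
      have h1 := hT.card_through_le_one h𝓢 (A := A) (by omega) (by omega)
      have h3 : extCount k j = 3 := by
        rw [extCount, hj, show 2 * (k - (k - 2)) - 1 = 3 by omega]; rfl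
      have hTk := hT.card_le h𝓢
      rw [h3]
      obtain h | h : #T - j = 1 ∨ #T - j = 2 := by omega
      · rw [h]; omega
      · rw [h]; omega
  | succ d ih =>
    obtain ⟨e, he⟩ : ∃ e, #T - j = e + 1 := ⟨#T - j - 1, by omega⟩
    have he' : #T - (j + 1) = e := by omega
    have hstep := hT.card_through_le_mul h𝓢 (A := A) (by omega)
      (B := 3 ^ e * extCount k (j + 1) / 5 ^ e) fun A' hA' => by
        rw [Nat.le_div_iff_mul_le (by positivity), mul_comm]
        have := ih (j := j + 1) (by omega) A' (by omega)
        rwa [he'] at this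
    have hdiv := Nat.mul_div_le (3 ^ e * extCount k (j + 1)) (5 ^ e)
    rw [hA] at hstep
    rw [he, extCount_of_lt (by omega)]
    have hm : 5 * (k - j) ≤ 3 * (2 * (k - j) - 1) := by omega
    calc 5 ^ (e + 1) * #(through 𝓢 A)
        ≤ 5 ^ (e + 1) * ((k - j) * (3 ^ e * extCount k (j + 1) / 5 ^ e)) :=
          Nat.mul_le_mul_left _ hstep
      _ = (5 * (k - j)) * (5 ^ e * (3 ^ e * extCount k (j + 1) / 5 ^ e)) := by ring
      _ ≤ (3 * (2 * (k - j) - 1)) * (3 ^ e * extCount k (j + 1)) := Nat.mul_le_mul hm hdiv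
      _ = 3 ^ (e + 1) * ((2 * (k - j) - 1) * extCount k (j + 1)) := by ring

lemma card_lt_of_four_le (h𝓢 : IsTwoIntersecting 𝓢) (hT : IsMinCover 𝓢 T) (hT4 : 4 ≤ #T) :
    #𝓢 < extCount k 2 := by
  have hTk := hT.card_le h𝓢
  have hsum := hT.card_le_sum_add
  have hw : ∀ j, ∀ A : Finset (Sym2 (Fin (2 * k))), #A = j → #(through 𝓢 A) ≤ extCount k j := by
    rintro j A rfl
    exact card_through_le h𝓢.isPM A
  have hthree : ∀ {B}, (∀ A, #A = 4 → #(through 𝓢 A) ≤ B) →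
      ∀ A, #A = 3 → #(through 𝓢 A) ≤ (k - 3) * B := by
    intro B hB A hA
    rw [← hA]
    exact hT.card_through_le_mul h𝓢 (by omega) fun A' hA' => hB A' (by omega)
  have hw2 : extCount k 2 = (2 * (k - 4) + 3) * ((2 * (k - 4) + 1) * extCount k 4) := by
    rw [extCount_of_lt (by omega : 2 < k), extCount_of_lt (by omega : 2 + 1 < k)]
    congr 2 <;> omega
  rcases hT4.eq_or_lt with h4 | h5
  · have h1 := hT.sum_card_withTrace_le_of_card_eq_four h𝓢 h4.symm (hw 4)
    have hpos := extCount_pos k 4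
    rw [hw2]
    rcases hTk.eq_or_lt with hk | hk
    · have h2 := hT.card_filter_three_le_one h𝓢 hk (by omega)
      obtain rfl : k = 4 := by omega
      rw [Nat.sub_self, zero_mul, zero_mul, mul_zero] at h1
      omega
    · have h2 := card_filter_three_le (T := T) (hthree (hw 4))
      rw [← h4, show Nat.choose 4 3 = 4 from rfl] at h2
      obtain ⟨m, rfl⟩ := Nat.exists_eq_add_of_le (by omega : 5 ≤ k)
      rw [show 5 + m - 4 = m + 1 by omega] at *
      rw [show 5 + m - 3 = m + 2 by omega] at h2
      nlinarith [Nat.zero_le (m * m * extCount (5 + m) 4), Nat.zero_le (m * extCount (5 + m) 4)]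
  · rcases (by omega : k = 5 ∨ k = 6 ∨ 7 ≤ k) with rfl | rfl | hk
    · have h1 := hT.two_mul_sum_card_withTrace_le h𝓢 hT4 (hw 4)
      have h2 := hT.card_filter_three_le_one h𝓢 (by omega) le_rfl
      have h5' : #T = 5 := by omega
      rw [hw2]
      have hw4 : extCount 5 4 = 1 := rfl
      rw [h5', hw4, show Nat.choose 5 2 = 10 from rfl] at h1
      rw [hw4]
      norm_num at h1 ⊢
      omega
    · have hone : ∀ A, #A = 4 → #(through 𝓢 A) ≤ 1 := fun A hA =>
        hT.card_through_le_one h𝓢 (by omega) (by omega)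
      have h1 := hT.two_mul_sum_card_withTrace_le h𝓢 hT4 hone
      have h2 := card_filter_three_le (T := T) (hthree hone)
      rw [hw2, show extCount 6 4 = 3 from rfl]
      obtain h | h : #T = 5 ∨ #T = 6 := by omega
      · rw [h, show Nat.choose 5 2 = 10 from rfl] at h1
        rw [h, show Nat.choose 5 3 = 10 from rfl] at h2
        norm_num at *
        omega
      · rw [h, show Nat.choose 6 2 = 15 from rfl] at h1
        rw [h, show Nat.choose 6 3 = 20 from rfl] at h2
        norm_num at *
        omega
    · obtain ⟨t, ht⟩ := Nat.exists_eq_add_of_le (show 5 ≤ #T from h5)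
      obtain ⟨m, hm⟩ := Nat.exists_eq_add_of_le hk
      set w := extCount k 5 with hwdef
      set c := 3 ^ t * w / 5 ^ t with hc
      have hct : 5 ^ t * c ≤ 3 ^ t * w := Nat.mul_div_le _ _
      have hfive : ∀ A, #A = 5 → #(through 𝓢 A) ≤ c := by
        intro A hA
        rw [hc, Nat.le_div_iff_mul_le (by positivity), mul_comm]
        have := hT.pow_mul_card_through_le h𝓢 (j := 5) (d := min #T (k - 2) - 5) (by omega)
          (by omega) A hA
        rwa [show #T - 5 = t by omega] at this
      have hfour : ∀ A, #A = 4 → #(through 𝓢 A) ≤ (k - 4) * c := by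
        intro A hA
        have := hT.card_through_le_mul h𝓢 (A := A) (by omega) fun A' hA' => hfive A' (by omega)
        rwa [hA] at this
      have h1 := hT.two_mul_sum_card_withTrace_le h𝓢 hT4 hfour
      have h2 := card_filter_three_le (T := T) (hthree hfour)
      have hw4 : extCount k 4 = (2 * (k - 4) - 1) * w := extCount_of_lt (by omega)
      have hwpos : 0 < w := extCount_pos k 5
      rw [hw2, hw4]
      rw [show k - 3 = m + 4 by omega] at h2
      rw [show k - 4 = m + 3 by omega] at *
      rw [show 2 * (m + 3) - 1 = 2 * m + 5 by omega]
      rw [ht] at h1 h2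
      clear_value w c
      exact lt_of_trace_bounds hct hwpos hsum h1 h2

/-! ### Covers of size three -/

lemma card_le_sum_erase_add (hT : IsMinCover 𝓢 T) (hT3 : #T = 3) :
    #𝓢 ≤ ∑ x ∈ T, #(withTrace 𝓢 T (T.erase x)) + #(through 𝓢 T) := by
  have h : 𝓢 ⊆ T.biUnion (fun x => withTrace 𝓢 T (T.erase x)) ∪ through 𝓢 T := by
    intro P hP
    have h2 := hT.two_le P hP
    by_cases hTP : T ⊆ P
    · exact mem_union_right _ (mem_through.2 ⟨hP, hTP⟩)
    · obtain ⟨x, hx, hxP⟩ := not_subset.1 hTP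
      refine mem_union_left _ (mem_biUnion.2 ⟨x, hx, mem_withTrace.2 ⟨hP, ?_⟩⟩)
      refine eq_of_subset_of_card_le (fun e he => ?_) (by rw [card_erase_of_mem hx]; omega)
      rw [mem_inter] at he
      exact mem_erase.2 ⟨by rintro rfl; exact hxP he.2, he.1⟩
  exact (card_le_card h).trans ((card_union_le _ _).trans (Nat.add_le_add_right card_biUnion_le _))

lemma card_inter_of_mem_withTrace {x y : Sym2 (Fin (2 * k))} (hT3 : #T = 3) (hx : x ∈ T)
    (hy : y ∈ T) (hxy : x ≠ y) (hR : R ∈ withTrace 𝓢 T (T.erase y)) :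
    #(T.erase x ∩ R) = 1 := by
  have h : T.erase x ∩ R = (T.erase y).erase x := by
    rw [← (mem_withTrace.1 hR).2]; ext; simp
  rw [h, card_erase_of_mem (mem_erase.2 ⟨hxy, hx⟩), card_erase_of_mem hy]
  omega

lemma card_withTrace_erase_le (h𝓢 : IsTwoIntersecting 𝓢) (hT : IsMinCover 𝓢 T) (hT3 : #T = 3)
    {x : Sym2 (Fin (2 * k))} (hx : x ∈ T) :
    #(withTrace 𝓢 T (T.erase x)) ≤ (k - 4) * extCount k 3 := by
  rcases (withTrace 𝓢 T (T.erase x)).eq_empty_or_nonempty with h0 | ⟨P₀, hP₀⟩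
  · simp [h0]
  have hp2 : #(T.erase x) = 2 := by rw [card_erase_of_mem hx]; omega
  obtain ⟨R, hR, hpR⟩ := hT.exists_of_card_lt P₀ (mem_withTrace.1 hP₀).1 _
    (subset_of_mem_withTrace hP₀) (by omega)
  have h2 := hT.two_le R hR
  have h3 : #(T ∩ R) ≤ #(T.erase x ∩ R) + 1 := by
    rw [erase_inter]
    have := pred_card_le_card_erase (s := T ∩ R) (a := x)
    omega
  refine card_withTrace_le_of_card_inter_eq_one h𝓢 hT (erase_subset _ _) hp2 hR (by omega)
    fun y hy => ?_
  refine (card_through_le (fun P hP => h𝓢.isPM P (mem_withTrace.1 hP).1) _).trans_eq ?_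
  rw [card_insert_of_notMem fun h => hy (mem_of_mem_erase h), hp2]

/-- If all members with one trace share three edges with some member with another trace, then
the first trace is rare. -/
lemma two_mul_card_withTrace_erase_le (h𝓢 : IsTwoIntersecting 𝓢) (hT : IsMinCover 𝓢 T)
    (hT3 : #T = 3) {x y : Sym2 (Fin (2 * k))} (hx : x ∈ T) (hy : y ∈ T) (hxy : x ≠ y)
    {Q : Finset (Sym2 (Fin (2 * k)))} (hQ : Q ∈ withTrace 𝓢 T (T.erase y))
    (h3 : ∀ P ∈ withTrace 𝓢 T (T.erase x), 3 ≤ #(P ∩ Q)) :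
    2 * #(withTrace 𝓢 T (T.erase x)) ≤ (k - 4) * (k - 4) * extCount k 4 := by
  have hp2 : #(T.erase x) = 2 := by rw [card_erase_of_mem hx]; omega
  have hQ' := (mem_withTrace.1 hQ).1
  have h1 := card_inter_of_mem_withTrace hT3 hx hy hxy hQ
  have hU := card_usable_add_four_le_of_card_inter_eq_one h𝓢 hT (erase_subset x T) hp2 hQ' h1
  have h : #(withTrace 𝓢 T (T.erase x)) ≤
      (#(usable Q (T.erase x) T)).choose 2 * extCount k 4 := by
    refine card_le_choose_mul_of_two_le (A := T.erase x)
      (fun P hP => subset_of_mem_withTrace hP) (fun P hP => ?_) (fun D hD hD2 => ?_)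
    · have hP' := mem_withTrace.1 hP
      have h4 := card_sdiff_add_card_inter (P ∩ Q) T
      have h5 : P ∩ Q ∩ T = T.erase x ∩ Q := by
        rw [← hP'.2]; ext; simp; tauto
      rw [h5, h1] at h4
      have h6 := h3 P hP
      refine (by omega : 2 ≤ #((P ∩ Q) \ T)).trans (card_le_card fun e he => ?_)
      simp only [mem_sdiff, mem_inter] at he
      exact mem_inter.2 ⟨he.1.1, (h𝓢.isPM P hP'.1).mem_usable (subset_of_mem_withTrace hP)
        he.1.1 he.1.2 he.2 fun h => he.2 (mem_of_mem_erase h)⟩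
    · refine (card_through_le (fun P hP => h𝓢.isPM P (mem_withTrace.1 hP).1) _).trans_eq ?_
      rw [card_union_of_disjoint, hD2, hp2]
      rw [Finset.disjoint_left]
      intro e he
      exact h𝓢.notMem_of_mem_usable hQ' (hD he)
  have h2 := Nat.mul_le_mul_right (extCount k 4)
    ((two_mul_choose_two_le (#(usable Q (T.erase x) T))).trans
      (Nat.mul_le_mul (by omega : _ ≤ k - 4) (by omega : _ ≤ k - 4)))
  linarith

/-- If members with the two other traces share just two edges, then a member with the remaining
trace contains the second shared edge or two further edges. -/
lemma card_withTrace_erase_le_of_card_inter_eq_two (h𝓢 : IsTwoIntersecting 𝓢)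
    (hT : IsMinCover 𝓢 T) (hT3 : #T = 3) {x y z : Sym2 (Fin (2 * k))} (hx : x ∈ T) (hy : y ∈ T)
    (hz : z ∈ T) (hxy : x ≠ y) (hxz : x ≠ z) (hyz : y ≠ z)
    (hP : P ∈ withTrace 𝓢 T (T.erase y)) (hR : R ∈ withTrace 𝓢 T (T.erase z))
    (hPR : #(P ∩ R) = 2) :
    5 ≤ k ∧ #(withTrace 𝓢 T (T.erase x)) ≤
      extCount k 3 + (k - 5) * (k - 5) * extCount k 4 := by
  have hp2 : #(T.erase x) = 2 := by rw [card_erase_of_mem hx]; omega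
  have hP' := mem_withTrace.1 hP
  have hR' := mem_withTrace.1 hR
  have hPM := h𝓢.isPM P hP'.1
  have hRM := h𝓢.isPM R hR'.1
  have h1P := card_inter_of_mem_withTrace hT3 hx hy hxy hP
  have h1R := card_inter_of_mem_withTrace hT3 hx hz hxz hR
  have hUP := card_usable_add_four_le_of_card_inter_eq_one h𝓢 hT (erase_subset x T) hp2 hP'.1 h1P
  have hUR := card_usable_add_four_le_of_card_inter_eq_one h𝓢 hT (erase_subset x T) hp2 hR'.1 h1R
  have memP : ∀ e ∈ T, (e ∈ P ↔ e ≠ y) := by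
    intro e he
    have := congrArg (e ∈ ·) hP'.2
    simpa [he] using this
  have memR : ∀ e ∈ T, (e ∈ R ↔ e ≠ z) := by
    intro e he
    have := congrArg (e ∈ ·) hR'.2
    simpa [he] using this
  have hT' : ∀ e ∈ T, e = x ∨ e = y ∨ e = z := by
    have hsub : ({x, y, z} : Finset _) ⊆ T := by
      simp [insert_subset_iff, hx, hy, hz]
    have := eq_of_subset_of_card_le hsub (by rw [hT3, card_eq_three.2 ⟨x, y, z, hxy, hxz, hyz, rfl⟩])
    intro e he
    rw [← this] at he
    simpa using he
  obtain ⟨e, he, hex⟩ := exists_mem_ne (by omega : 1 < #(P ∩ R)) x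
  have hxPR : x ∈ P ∩ R := mem_inter.2 ⟨(memP x hx).2 hxy, (memR x hx).2 hxz⟩
  have hPReq : ∀ f ∈ P, f ∈ R → f = x ∨ f = e := by
    have hsub : ({x, e} : Finset _) ⊆ P ∩ R := by
      simp only [insert_subset_iff, singleton_subset_iff]; exact ⟨hxPR, he⟩
    have := eq_of_subset_of_card_le hsub (by rw [hPR, card_pair hex.symm])
    intro f hfP hfR
    have hf := mem_inter.2 ⟨hfP, hfR⟩
    rw [← this] at hf
    simpa using hf
  rw [mem_inter] at he
  have heT : e ∉ T := by
    intro h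
    rcases hT' e h with rfl | rfl | rfl
    · exact hex rfl
    · exact (memP _ hy).1 he.1 rfl
    · exact (memR _ hz).1 he.2 rfl
  have hedisj : Disjoint e.toFinset (coveredVerts (T.erase x)) := by
    rw [coveredVerts, disjoint_biUnion_right]
    intro f hf
    rw [mem_erase] at hf
    rcases hT' f hf.2 with rfl | rfl | rfl
    · exact absurd rfl hf.1
    · exact hRM.disjoint_toFinset he.2 ((memR _ hf.2).2 hyz) (by rintro rfl; exact heT hf.2)
    · exact hPM.disjoint_toFinset he.1 ((memP _ hf.2).2 hyz.symm) (by rintro rfl; exact heT hf.2)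
  have heP : e ∈ usable P (T.erase x) T := mem_usable.2 ⟨he.1, heT, hedisj⟩
  have heR : e ∈ usable R (T.erase x) T := mem_usable.2 ⟨he.2, heT, hedisj⟩
  have hcP := card_erase_add_one heP
  have hcR := card_erase_add_one heR
  refine ⟨by omega, ?_⟩
  have h𝓕 : ∀ Q ∈ withTrace 𝓢 T (T.erase x), IsPM Q :=
    fun Q hQ => h𝓢.isPM Q (mem_withTrace.1 hQ).1
  rw [← card_filter_add_card_filter_not (fun Q => e ∈ Q)]
  refine Nat.add_le_add ?_ ?_
  · refine (card_le_card (t := through (withTrace 𝓢 T (T.erase x)) (insert e (T.erase x)))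
      fun Q hQ => ?_).trans ((card_through_le h𝓕 _).trans_eq ?_)
    · rw [mem_filter] at hQ
      exact mem_through.2 ⟨hQ.1, insert_subset hQ.2 (subset_of_mem_withTrace hQ.1)⟩
    · rw [card_insert_of_notMem fun h => heT (mem_of_mem_erase h), hp2]
  · refine (card_le_card_mul_of_forall_exists_subset
      (𝓓 := ((usable P (T.erase x) T).erase e ×ˢ (usable R (T.erase x) T).erase e).image
        fun q => insert q.1 (insert q.2 (T.erase x))) (B := extCount k 4)
      (fun Q hQ => ?_) (fun D hD => ?_)).trans (Nat.mul_le_mul_right _ (card_image_le.trans ?_))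
    · rw [mem_filter] at hQ
      have hQp := subset_of_mem_withTrace hQ.1
      obtain ⟨f, hfQ, hfP, hfT⟩ := exists_mem_inter_sdiff h𝓢 hQ.1 hP'.1 h1P.le
      obtain ⟨g, hgQ, hgR, hgT⟩ := exists_mem_inter_sdiff h𝓢 hQ.1 hR'.1 h1R.le
      have hf := (h𝓕 Q hQ.1).mem_usable hQp hfQ hfP hfT fun h => hfT (mem_of_mem_erase h)
      have hg := (h𝓕 Q hQ.1).mem_usable hQp hgQ hgR hgT fun h => hgT (mem_of_mem_erase h)
      refine ⟨_, mem_image_of_mem _ (mk_mem_product (mem_erase.2 ⟨?_, hf⟩)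
        (mem_erase.2 ⟨?_, hg⟩)), insert_subset hfQ (insert_subset hgQ hQp)⟩
      · rintro rfl; exact hQ.2 hfQ
      · rintro rfl; exact hQ.2 hgQ
    · obtain ⟨⟨f, g⟩, hfg, rfl⟩ := mem_image.1 hD
      rw [mem_product, mem_erase, mem_erase, mem_usable, mem_usable] at hfg
      obtain ⟨⟨hfe, hfP, hfT, -⟩, -, hgR, hgT, -⟩ := hfg
      have hne : f ≠ g := by
        rintro rfl
        rcases hPReq f hfP hgR with rfl | rfl
        · exact hfT hx
        · exact hfe rfl
      refine (card_through_le (fun Q hQ => h𝓕 Q (mem_filter.1 hQ).1) _).trans_eq ?_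
      rw [card_insert_of_notMem, card_insert_of_notMem fun h => hgT (mem_of_mem_erase h), hp2]
      rw [mem_insert, not_or]
      exact ⟨hne, fun h => hfT (mem_of_mem_erase h)⟩
    · rw [card_product]
      exact Nat.mul_le_mul (by omega) (by omega)

lemma card_lt_of_eq_three (h𝓢 : IsTwoIntersecting 𝓢) (hT : IsMinCover 𝓢 T) (hT3 : #T = 3)
    (hk : 4 ≤ k) : #𝓢 < extCount k 2 := by
  have hsum := hT.card_le_sum_erase_add hT3
  have hthr : #(through 𝓢 T) ≤ extCount k 3 := by
    have := card_through_le h𝓢.isPM T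
    rwa [hT3] at this
  have hle := fun x hx => hT.card_withTrace_erase_le h𝓢 hT3 (x := x) hx
  have hw2 : extCount k 2 = (2 * (k - 4) + 3) * extCount k 3 := by
    rw [extCount_of_lt (by omega : 2 < k)]
    congr 1; omega
  have hw3 : extCount k 3 = (2 * (k - 4) + 1) * extCount k 4 := by
    rw [extCount_of_lt (by omega : 3 < k)]
    congr 1; omega
  have hpos3 := extCount_pos k 3
  have hpos4 := extCount_pos k 4
  by_cases hempty : ∃ x ∈ T, withTrace 𝓢 T (T.erase x) = ∅
  · obtain ⟨x, hx, h0⟩ := hempty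
    rw [← add_sum_erase _ _ hx, h0, card_empty, zero_add] at hsum
    have h1 := sum_le_card_nsmul (T.erase x) (fun x => #(withTrace 𝓢 T (T.erase x)))
      ((k - 4) * extCount k 3) fun y hy => hle y (mem_of_mem_erase hy)
    rw [card_erase_of_mem hx, hT3, smul_eq_mul] at h1
    norm_num at h1
    rw [hw2]
    nlinarith
  push Not at hempty
  by_cases hlarge : ∃ x ∈ T, ∃ y ∈ T, x ≠ y ∧ ∀ P ∈ withTrace 𝓢 T (T.erase x),
      ∀ Q ∈ withTrace 𝓢 T (T.erase y), 3 ≤ #(P ∩ Q)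
  · obtain ⟨x, hx, y, hy, hxy, h⟩ := hlarge
    obtain ⟨P, hP⟩ := hempty x hx
    obtain ⟨Q, hQ⟩ := hempty y hy
    have h1 := hT.two_mul_card_withTrace_erase_le h𝓢 hT3 hx hy hxy hQ fun P hP => h P hP Q hQ
    have h2 := hT.two_mul_card_withTrace_erase_le h𝓢 hT3 hy hx hxy.symm hP
      fun Q hQ => inter_comm P Q ▸ h P hP Q hQ
    have hy' : y ∈ T.erase x := mem_erase.2 ⟨hxy.symm, hy⟩
    rw [← add_sum_erase _ _ hx, ← add_sum_erase _ _ hy'] at hsum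
    have h3 := sum_le_card_nsmul ((T.erase x).erase y) (fun x => #(withTrace 𝓢 T (T.erase x)))
      ((k - 4) * extCount k 3) fun y hy => hle y (mem_of_mem_erase (mem_of_mem_erase hy))
    rw [card_erase_of_mem hy', card_erase_of_mem hx, hT3, smul_eq_mul] at h3
    norm_num at h3
    rw [hw2, hw3]
    rw [hw3] at h3 hthr
    nlinarith [Nat.zero_le ((k - 4) * (k - 4) * extCount k 4),
      Nat.zero_le ((k - 4) * extCount k 4)]
  · push Not at hlarge
    have key : ∀ x ∈ T, 5 ≤ k ∧ #(withTrace 𝓢 T (T.erase x)) ≤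
        extCount k 3 + (k - 5) * (k - 5) * extCount k 4 := by
      intro x hx
      obtain ⟨y, z, hyz, hyz'⟩ := card_eq_two.1
        (by rw [card_erase_of_mem hx, hT3] : #(T.erase x) = 2)
      have hy : y ∈ T.erase x := by simp [hyz']
      have hz : z ∈ T.erase x := by simp [hyz']
      rw [mem_erase] at hy hz
      obtain ⟨P, hP, R, hR, hPR⟩ := hlarge y hy.2 z hz.2 hyz
      have := h𝓢.inter P (mem_withTrace.1 hP).1 R (mem_withTrace.1 hR).1
      exact hT.card_withTrace_erase_le_of_card_inter_eq_two h𝓢 hT3 hx hy.2 hz.2 hy.1.symm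
        hz.1.symm hyz hP hR (by omega)
    obtain ⟨x, hx⟩ := card_pos.1 (by omega : 0 < #T)
    have h1 := sum_le_card_nsmul T (fun x => #(withTrace 𝓢 T (T.erase x))) _
      fun x hx => (key x hx).2
    rw [hT3, smul_eq_mul] at h1
    obtain ⟨m, rfl⟩ := Nat.exists_eq_add_of_le (key x hx).1
    rw [show 5 + m - 4 = m + 1 by omega] at *
    rw [show 5 + m - 5 = m by omega] at h1
    rw [hw2, hw3]
    rw [hw3] at h1 hthr
    nlinarith [Nat.zero_le (m * m * extCount (5 + m) 4), Nat.zero_le (m * extCount (5 + m) 4)]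

end IsMinCover

lemma IsTwoIntersecting.exists_isMinCover {𝓢 : Finset (Finset (Sym2 (Fin (2 * k))))}
    (h𝓢 : IsTwoIntersecting 𝓢) (hne : 𝓢.Nonempty) : ∃ T, IsMinCover 𝓢 T := by
  obtain ⟨P, hP⟩ := hne
  obtain ⟨T, hT, hmin⟩ := exists_min_image
    (univ.filter fun T => (∃ P ∈ 𝓢, T ⊆ P) ∧ ∀ R ∈ 𝓢, 2 ≤ #(T ∩ R)) card
    ⟨P, mem_filter.2 ⟨mem_univ _, ⟨P, hP, subset_rfl⟩, h𝓢.inter P hP⟩⟩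
  rw [mem_filter] at hT
  refine ⟨T, hT.2.1, hT.2.2, fun Q hQ A hA hlt => ?_⟩
  by_contra! h
  exact absurd (hmin A (mem_filter.2 ⟨mem_univ _, ⟨Q, hQ, hA⟩, fun R hR => h R hR⟩)) (by omega)

/-- A 2-intersecting family of the maximum size `(2k-5)!!` consists of the perfect matchings
containing two fixed edges. -/
lemma IsTwoIntersecting.exists_eq_through {𝓢 : Finset (Finset (Sym2 (Fin (2 * k))))}
    (h𝓢 : IsTwoIntersecting 𝓢) (hk : 3 ≤ k) (hcard : #𝓢 = extCount k 2) :
    ∃ T, #T = 2 ∧ (∃ P ∈ 𝓢, T ⊆ P) ∧ 𝓢 = through (univ.filter IsPM) T := by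
  obtain ⟨T, hT⟩ := h𝓢.exists_isMinCover (card_pos.1 (hcard ▸ extCount_pos k 2))
  obtain ⟨P, hP, hTP⟩ := hT.exists_superset
  have hT2 : #T = 2 := by
    have h2 : 2 ≤ #T := (hT.two_le P hP).trans (card_le_card inter_subset_left)
    by_contra hne
    rcases (by omega : #T = 3 ∨ 4 ≤ #T) with h3 | h4
    · rcases hk.eq_or_lt with rfl | hk
      · obtain ⟨A, hA, hA2⟩ := exists_subset_card_eq h2
        obtain ⟨R, hR, hAR⟩ := hT.exists_of_card_lt P hP A (hA.trans hTP) (by omega)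
        have h1 : #𝓢 ≤ 1 := hcard.le
        obtain rfl := card_le_one.1 h1 P hP R hR
        rw [inter_eq_left.2 (hA.trans hTP)] at hAR
        omega
      · exact (hT.card_lt_of_eq_three h𝓢 h3 hk).ne hcard
    · exact (hT.card_lt_of_four_le h𝓢 h4).ne hcard
  refine ⟨T, hT2, ⟨P, hP, hTP⟩, eq_of_subset_of_card_le (fun Q hQ => ?_) ?_⟩
  · have h1 := eq_of_subset_of_card_le (inter_subset_left (s₁ := T) (s₂ := Q))
      (by rw [hT2]; exact hT.two_le Q hQ)
    exact mem_through.2 ⟨mem_filter.2 ⟨mem_univ _, h𝓢.isPM Q hQ⟩, inter_eq_left.1 h1⟩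
  · have h1 := card_through_le (𝓢 := univ.filter IsPM) (fun P hP => (mem_filter.1 hP).2) T
    rwa [hT2, ← hcard] at h1

end Branching

/-- **Characterization of maximum 2-intersecting families.**  Let `k ≥ 3` and let `S` be a
family of perfect matchings of `K_{2k}`, any two of which share at least two edges, with
`|S| = (2k-5)!!`.  Then the characteristic vector of `S` lies in the real span of the vectors
`ν_{e₁,e₂}` taken over all pairs of disjoint (non-loop, vertex-disjoint) edges `e₁, e₂` of
`K_{2k}`, where `ν_{e₁,e₂}` is the 0/1 vector whose entry at a perfect matching `P` is `1`
exactly when `P` contains both `e₁` and `e₂`. -/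
theorem maximum_two_intersecting_characterization (k : ℕ) (hk : 3 ≤ k)
    (S : Finset (PM (2 * k)))
    (hS : ∀ P ∈ S, ∀ Q ∈ S, 2 ≤ (P.1 ∩ Q.1).card)
    (hcard : S.card = Nat.doubleFactorial (2 * k - 5)) :
    (fun P : PM (2 * k) => if P ∈ S then (1 : ℝ) else 0) ∈
      Submodule.span ℝ
        {ν : PM (2 * k) → ℝ | ∃ e₁ e₂ : Sym2 (Fin (2 * k)),
          ¬ e₁.IsDiag ∧ ¬ e₂.IsDiag ∧ (∀ v : Fin (2 * k), ¬ (v ∈ e₁ ∧ v ∈ e₂)) ∧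
          ν = fun P : PM (2 * k) => if e₁ ∈ P.1 ∧ e₂ ∈ P.1 then (1 : ℝ) else 0} := by
  classical
  have hinj : Function.Injective (Subtype.val : PM (2 * k) → _) := Subtype.val_injective
  have h𝓢 : IsTwoIntersecting (S.image Subtype.val) := by
    constructor
    · intro P hP
      obtain ⟨P', -, rfl⟩ := Finset.mem_image.1 hP
      exact P'.2
    · intro P hP Q hQ
      obtain ⟨P', hP', rfl⟩ := Finset.mem_image.1 hP
      obtain ⟨Q', hQ', rfl⟩ := Finset.mem_image.1 hQ
      exact hS P' hP' Q' hQ'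
  obtain ⟨T, hT2, ⟨P₀, hP₀, hTP₀⟩, hST⟩ := h𝓢.exists_eq_through hk (by
    rw [Finset.card_image_of_injective _ hinj, hcard, extCount]
    congr 1
    omega)
  obtain ⟨e₁, e₂, hne, rfl⟩ := Finset.card_eq_two.1 hT2
  have hPM := h𝓢.isPM P₀ hP₀
  have h₁ : e₁ ∈ P₀ := hTP₀ (by simp)
  have h₂ : e₂ ∈ P₀ := hTP₀ (by simp)
  refine Submodule.subset_span ⟨e₁, e₂, hPM.1 _ h₁, hPM.1 _ h₂,
    fun v hv => hne (hPM.eq_of_mem h₁ h₂ hv.1 hv.2), ?_⟩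
  funext P
  have hP : P ∈ S ↔ e₁ ∈ P.1 ∧ e₂ ∈ P.1 := by
    rw [← hinj.mem_finset_image, hST, mem_through]
    simp [Finset.insert_subset_iff, P.2]
  simp [hP]
end

section
/- Let k ≥ 2 and let P be a perfect matching of K_{2k}. Then the number of perfect matchings Q of K_{2k} having no edge in common with P such that the graph on {1,…,2k} with edge set P ∪ Q is connected (i.e., P ∪ Q is a single 2k-cycle) equals (2k−2)!! = (2k−2)(2k−4)⋯2. -/
/-- An involution of `V` without fixed points, the function form of a perfect matching. -/
def IsFPFInvolution {V : Type*} (q : V → V) : Prop :=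
  ∀ x, q (q x) = x ∧ q x ≠ x

/-- Every nonempty set closed under `p` and `q` is everything. -/
def JointlyTransitive {V : Type*} (p q : V → V) : Prop :=
  ∀ S : Set V, S.Nonempty → (∀ x ∈ S, p x ∈ S) → (∀ x ∈ S, q x ∈ S) → ∀ x, x ∈ S

theorem IsFPFInvolution.eq_iff {V : Type*} {q : V → V} (hq : IsFPFInvolution q) {x y : V} :
    q x = y ↔ x = q y := by
  constructor
  · rintro rfl
    exact (hq x).1.symm
  · rintro rfl
    exact (hq y).1

section Contract

variable {V : Type*} [DecidableEq V]

/-- The vertices other than `v` and `w`. -/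
abbrev Avoiding (v w : V) : Type _ := {x : V // x ≠ v ∧ x ≠ w}

/-- Remove `v` and `w` from the involution `p` and match their former partners. -/
def contractFun (p : V → V) (v w x : V) : V :=
  if p x = v then p w else if p x = w then p v else p x

theorem contractFun_avoids {p : V → V} (hp : IsFPFInvolution p) {v w : V}
    (hpv : w ≠ p v) (x : Avoiding v w) :
    contractFun p v w x ≠ v ∧ contractFun p v w x ≠ w := by
  have h1 := hp v
  have h2 := hp w
  have h3 := hp x
  obtain ⟨x, hx⟩ := x
  unfold contractFun
  grind

/-- `contractFun` as a function on the remaining vertices. -/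
def contract {p : V → V} (hp : IsFPFInvolution p) {v w : V} (hpv : w ≠ p v)
    (x : Avoiding v w) : Avoiding v w :=
  ⟨contractFun p v w x, contractFun_avoids hp hpv x⟩

theorem isFPFInvolution_contract {p : V → V} (hp : IsFPFInvolution p) {v w : V} (hvw : w ≠ v)
    (hpv : w ≠ p v) : IsFPFInvolution (contract hp hpv) := by
  rintro ⟨x, hx⟩
  have h1 := hp v
  have h2 := hp w
  have h3 := hp x
  simp only [contract, Subtype.mk.injEq, ne_eq]
  unfold contractFun
  grind

/-- Extend a function on the remaining vertices by exchanging `v` and `w`. -/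
def extendSwap {v w : V} (r : Avoiding v w → Avoiding v w) (x : V) : V :=
  if h : x ≠ v ∧ x ≠ w then r ⟨x, h⟩ else if x = v then w else v

theorem extendSwap_coe {v w : V} (r : Avoiding v w → Avoiding v w) (x : Avoiding v w) :
    extendSwap r x = r x := by
  simp [extendSwap, x.2]

theorem extendSwap_left {v w : V} (r : Avoiding v w → Avoiding v w) : extendSwap r v = w := by
  simp [extendSwap]

theorem extendSwap_right {v w : V} (hvw : w ≠ v) (r : Avoiding v w → Avoiding v w) :
    extendSwap r w = v := by
  simp [extendSwap, hvw]

theorem extendSwap_injective (v w : V) :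
    Function.Injective (extendSwap : (Avoiding v w → Avoiding v w) → V → V) := by
  intro r s h
  funext x
  apply Subtype.ext
  rw [← extendSwap_coe, ← extendSwap_coe, h]

theorem forall_iff_avoiding {v w : V} {A : V → Prop} :
    (∀ x, A x) ↔ A v ∧ A w ∧ ∀ x : Avoiding v w, A x := by
  refine ⟨fun h => ⟨h v, h w, fun x => h x⟩, fun ⟨hv, hw, h⟩ x => ?_⟩
  by_cases hx : x = v
  · exact hx ▸ hv
  by_cases hx' : x = w
  · exact hx' ▸ hw
  exact h ⟨x, hx, hx'⟩

theorem isFPFInvolution_extendSwap {v w : V} (hvw : w ≠ v) (r : Avoiding v w → Avoiding v w) :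
    IsFPFInvolution (extendSwap r) ↔ IsFPFInvolution r := by
  unfold IsFPFInvolution
  rw [forall_iff_avoiding (v := v) (w := w)]
  simp only [extendSwap_left, extendSwap_right hvw, extendSwap_coe]
  simp [hvw, hvw.symm, Subtype.ext_iff]

theorem exists_extendSwap_eq {v w : V} (hvw : w ≠ v) {q : V → V} (hq : IsFPFInvolution q)
    (hqv : q v = w) : ∃ r : Avoiding v w → Avoiding v w, extendSwap r = q := by
  have hqw : q w = v := by rw [← hqv, (hq v).1]
  refine ⟨fun x => ⟨q x, ?_, ?_⟩, ?_⟩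
  · rw [Ne, hq.eq_iff, hqv]
    exact x.2.2
  · rw [Ne, hq.eq_iff, hqw]
    exact x.2.1
  · rw [funext_iff, forall_iff_avoiding (v := v) (w := w)]
    simp only [extendSwap_left, extendSwap_right hvw, extendSwap_coe]
    exact ⟨hqv.symm, hqw.symm, fun _ => trivial⟩

theorem jointlyTransitive_extendSwap {p : V → V} (hp : IsFPFInvolution p) {v w : V}
    (hvw : w ≠ v) (hpv : w ≠ p v) (r : Avoiding v w → Avoiding v w) :
    JointlyTransitive p (extendSwap r) ↔ JointlyTransitive (contract hp hpv) r := by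
  have hv := hp v
  have hw := hp w
  have hpvA : p v ≠ v ∧ p v ≠ w := ⟨hv.2, hpv.symm⟩
  have hpwA : p w ≠ v ∧ p w ≠ w := ⟨by rw [Ne, hp.eq_iff]; exact hpv, hw.2⟩
  constructor
  · intro h S ⟨s, hs⟩ hSp hSr
    have hpvw : (⟨p v, hpvA⟩ : Avoiding v w) ∈ S ↔ (⟨p w, hpwA⟩ : Avoiding v w) ∈ S := by
      have e1 : contract hp hpv ⟨p v, hpvA⟩ = ⟨p w, hpwA⟩ := by
        simp [contract, contractFun, hv.1]
      have e2 : contract hp hpv ⟨p w, hpwA⟩ = ⟨p v, hpvA⟩ := by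
        simp [contract, contractFun, hw.1, hvw]
      exact ⟨fun h => e1 ▸ hSp _ h, fun h => e2 ▸ hSp _ h⟩
    let T : Set V := {x | (∃ hx : x ≠ v ∧ x ≠ w, (⟨x, hx⟩ : Avoiding v w) ∈ S) ∨
      ((x = v ∨ x = w) ∧ (⟨p v, hpvA⟩ : Avoiding v w) ∈ S)}
    have hT : ∀ x, x ∈ T := by
      refine h T ⟨s, Or.inl ⟨s.2, hs⟩⟩ ?_ ?_
      · rintro x (⟨hx, hxS⟩ | ⟨rfl | rfl, hS⟩)
        · by_cases h1 : p x = v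
          · obtain rfl := hp.eq_iff.1 h1
            exact Or.inr ⟨Or.inl h1, hxS⟩
          by_cases h2 : p x = w
          · obtain rfl := hp.eq_iff.1 h2
            exact Or.inr ⟨Or.inr h2, hpvw.2 hxS⟩
          refine Or.inl ⟨⟨h1, h2⟩, ?_⟩
          have := hSp _ hxS
          simpa [contract, contractFun, h1, h2] using this
        · exact Or.inl ⟨hpvA, hS⟩
        · exact Or.inl ⟨hpwA, hpvw.1 hS⟩
      · rintro x (⟨hx, hxS⟩ | ⟨rfl | rfl, hS⟩)
        · have := extendSwap_coe r ⟨x, hx⟩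
          simp only at this
          rw [this]
          exact Or.inl ⟨(r ⟨x, hx⟩).2, hSr _ hxS⟩
        · rw [extendSwap_left]
          exact Or.inr ⟨Or.inr rfl, hS⟩
        · rw [extendSwap_right hvw]
          exact Or.inr ⟨Or.inl rfl, hS⟩
    intro x
    rcases hT x with ⟨_, hx⟩ | ⟨hx, _⟩
    · exact hx
    · exact absurd hx (not_or.2 x.2)
  · intro h S ⟨s, hs⟩ hSp hSq
    have hvw_mem : v ∈ S ↔ w ∈ S := by
      refine ⟨fun h => ?_, fun h => ?_⟩
      · simpa only [extendSwap_left] using hSq _ h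
      · simpa only [extendSwap_right hvw] using hSq _ h
    have hpv_mem : p v ∈ S → v ∈ S := fun h => hv.1 ▸ hSp _ h
    have hpw_mem : p w ∈ S → w ∈ S := fun h => hw.1 ▸ hSp _ h
    have hall : ∀ x : Avoiding v w, x ∈ ((↑) ⁻¹' S : Set (Avoiding v w)) := by
      refine h _ ?_ ?_ ?_
      · by_cases h1 : s = v
        · exact ⟨⟨p v, hpvA⟩, hSp _ (h1 ▸ hs)⟩
        by_cases h2 : s = w
        · exact ⟨⟨p w, hpwA⟩, hSp _ (h2 ▸ hs)⟩
        exact ⟨⟨s, h1, h2⟩, hs⟩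
      · intro x hx
        have hx' := hSp _ hx
        change contractFun p v w x ∈ S
        unfold contractFun
        split_ifs with h1 h2
        · exact hSp _ (hvw_mem.1 (h1 ▸ hx'))
        · exact hSp _ (hvw_mem.2 (h2 ▸ hx'))
        · exact hx'
      · intro x hx
        have := hSq _ hx
        rwa [extendSwap_coe] at this
    have hvS : v ∈ S := hpv_mem (hall ⟨p v, hpvA⟩)
    exact forall_iff_avoiding.2 ⟨hvS, hvw_mem.1 hvS, hall⟩

theorem card_avoiding [Fintype V] {v w : V} (hvw : w ≠ v) :
    Fintype.card (Avoiding v w) = Fintype.card V - 2 := by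
  have h : (Finset.univ.filter fun x : V => x ≠ v ∧ x ≠ w) = ({v, w} : Finset V)ᶜ := by
    ext x
    simp
  rw [Fintype.card_subtype, h, Finset.card_compl, Finset.card_pair hvw.symm]

end Contract

theorem JointlyTransitive.ne_of_two_lt_card {V : Type*} [Fintype V] {p q : V → V}
    (hp : IsFPFInvolution p) (hq : IsFPFInvolution q) (h : JointlyTransitive p q)
    (hV : 2 < Fintype.card V) (v : V) : q v ≠ p v := by
  classical
  intro hv
  have hS := h {v, p v} ⟨v, by simp⟩
    (by rintro x (rfl | rfl) <;> simp [(hp _).1])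
    (by rintro x (rfl | rfl)
        · simp [hv]
        · simp [← hv, (hq _).1])
  have hle : Fintype.card V ≤ ({v, p v} : Finset V).card :=
    Finset.card_le_card fun x _ => by simpa using hS x
  exact absurd (hle.trans Finset.card_le_two) (by omega)

/-- The fixed-point-free involutions that together with `p` act transitively are counted by a
double factorial. -/
theorem card_jointlyTransitive_involutions (n : ℕ) : ∀ {V : Type} [Fintype V] {p : V → V},
    IsFPFInvolution p → Fintype.card V = 2 * n + 2 →
    Nat.card {q : V → V // IsFPFInvolution q ∧ JointlyTransitive p q} =
      Nat.doubleFactorial (2 * n) := by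
  classical
  induction n with
  | zero =>
    intro V _ p hp hV
    have key : ∀ v x : V, x = v ∨ x = p v := by
      intro v x
      have h : ({v, p v} : Finset V) = Finset.univ := by
        rw [← Finset.card_eq_iff_eq_univ, Finset.card_pair (hp v).2.symm, hV]
      have := h ▸ Finset.mem_univ x
      simpa using this
    have hpp : JointlyTransitive p p := by
      intro S ⟨s, hs⟩ hS _ x
      rcases key s x with rfl | rfl
      · exact hs
      · exact hS _ hs
    simp only [Nat.doubleFactorial]
    rw [Nat.card_eq_one_iff_unique]
    refine ⟨⟨?_⟩, ⟨p, hp, hpp⟩⟩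
    have huniq : ∀ q : V → V, IsFPFInvolution q → q = p := fun q hq =>
      funext fun x => (key x (q x)).resolve_left (hq x).2
    rintro ⟨q, hq, _⟩ ⟨r, hr, _⟩
    exact Subtype.ext ((huniq q hq).trans (huniq r hr).symm)
  | succ n ih =>
    intro V _ p hp hV
    obtain ⟨v⟩ : Nonempty V := Fintype.card_pos_iff.1 (by omega)
    have hfiber : ∀ w ∈ ({v, p v} : Finset V)ᶜ,
        (Finset.univ.filter fun q : {q : V → V // IsFPFInvolution q ∧ JointlyTransitive p q} =>
          q.1 v = w).card = Nat.doubleFactorial (2 * n) := by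
      intro w hw
      obtain ⟨hvw, hpv⟩ : w ≠ v ∧ w ≠ p v := by simpa using hw
      rw [← ih (isFPFInvolution_contract hp hvw hpv) (by rw [card_avoiding hvw]; omega),
        ← Fintype.card_subtype, ← Nat.card_eq_fintype_card]
      symm
      refine Nat.card_congr (Equiv.ofBijective (fun r => ⟨⟨extendSwap r.1,
        (isFPFInvolution_extendSwap hvw r.1).2 r.2.1,
        (jointlyTransitive_extendSwap hp hvw hpv r.1).2 r.2.2⟩, extendSwap_left r.1⟩) ⟨?_, ?_⟩)
      · intro r s h
        simp only [Subtype.mk.injEq] at h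
        exact Subtype.ext (extendSwap_injective v w h)
      · rintro ⟨⟨q, hq, hpq⟩, hqv⟩
        obtain ⟨r, rfl⟩ := exists_extendSwap_eq hvw hq hqv
        exact ⟨⟨r, (isFPFInvolution_extendSwap hvw r).1 hq,
          (jointlyTransitive_extendSwap hp hvw hpv r).1 hpq⟩, rfl⟩
    rw [Nat.card_eq_fintype_card, ← Finset.card_univ,
      Finset.card_eq_sum_card_fiberwise (f := fun q => q.1 v) (t := ({v, p v} : Finset V)ᶜ),
      Finset.sum_congr rfl hfiber, Finset.sum_const, Finset.card_compl,
      Finset.card_pair (hp v).2.symm, hV, smul_eq_mul]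
    · rfl
    · rintro ⟨q, hq, hpq⟩ _
      have hne := hpq.ne_of_two_lt_card hp hq (by omega) v
      simp [(hq v).2, hne]

section Matching

variable {n : ℕ}

/-- The edges joining each vertex to its image. -/
def edgesOf (q : Fin n → Fin n) : Finset (Sym2 (Fin n)) :=
  Finset.univ.image fun x => s(x, q x)

theorem mk_mem_edgesOf {q : Fin n → Fin n} (hq : IsFPFInvolution q) {x y : Fin n} :
    s(x, y) ∈ edgesOf q ↔ y = q x := by
  simp only [edgesOf, Finset.mem_image, Finset.mem_univ, true_and]
  constructor
  · rintro ⟨z, hz⟩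
    rcases Sym2.eq_iff.1 hz with ⟨rfl, rfl⟩ | ⟨rfl, rfl⟩
    · rfl
    · exact (hq _).1.symm
  · rintro rfl
    exact ⟨x, rfl⟩

theorem isPM_edgesOf {q : Fin n → Fin n} (hq : IsFPFInvolution q) : IsPM (edgesOf q) := by
  refine ⟨fun e he => ?_, fun v => ⟨s(v, q v), ⟨(mk_mem_edgesOf hq).2 rfl, by simp⟩, ?_⟩⟩
  · induction e with
    | _ x y =>
      rw [mk_mem_edgesOf hq] at he
      subst he
      exact fun h => (hq x).2 (Sym2.mk_isDiag_iff.1 h).symm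
  · rintro e ⟨he, y, rfl⟩
    rw [mk_mem_edgesOf hq] at he
    rw [he]

theorem edgesOf_inj {q r : Fin n → Fin n} (hq : IsFPFInvolution q) (hr : IsFPFInvolution r)
    (h : edgesOf q = edgesOf r) : q = r :=
  funext fun _ => (mk_mem_edgesOf hr).1 (h ▸ (mk_mem_edgesOf hq).2 rfl)

theorem IsPM.exists_edgesOf_eq {Q : Finset (Sym2 (Fin n))} (hQ : IsPM Q) :
    ∃ q : Fin n → Fin n, IsFPFInvolution q ∧ edgesOf q = Q := by
  have hex : ∀ x, ∃ y, s(x, y) ∈ Q := by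
    intro x
    obtain ⟨e, ⟨he, y, rfl⟩, _⟩ := hQ.2 x
    exact ⟨y, he⟩
  choose q hq using hex
  have huniq : ∀ x y, s(x, y) ∈ Q → y = q x := fun x _ h =>
    Sym2.congr_right.1 ((hQ.2 x).unique ⟨h, by simp⟩ ⟨hq x, by simp⟩)
  have hinv : IsFPFInvolution q := fun x =>
    ⟨(huniq _ _ (Sym2.eq_swap ▸ hq x)).symm, fun h =>
      hQ.1 _ (hq x) (Sym2.mk_isDiag_iff.2 h.symm)⟩
  refine ⟨q, hinv, ?_⟩
  ext e
  induction e with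
  | _ x y =>
    rw [mk_mem_edgesOf hinv]
    exact ⟨fun h => h ▸ hq x, huniq x y⟩

theorem connected_edgesOf_union_iff [NeZero n] {p q : Fin n → Fin n} (hp : IsFPFInvolution p)
    (hq : IsFPFInvolution q) :
    (SimpleGraph.fromEdgeSet (↑(edgesOf p ∪ edgesOf q) : Set (Sym2 (Fin n)))).Connected ↔
      JointlyTransitive p q := by
  set G := SimpleGraph.fromEdgeSet (↑(edgesOf p ∪ edgesOf q) : Set (Sym2 (Fin n))) with hG
  have hadj : ∀ x y, G.Adj x y ↔ y = p x ∨ y = q x := by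
    intro x y
    rw [hG, SimpleGraph.fromEdgeSet_adj, Finset.mem_coe, Finset.mem_union, mk_mem_edgesOf hp,
      mk_mem_edgesOf hq, and_iff_left_iff_imp]
    rintro (rfl | rfl)
    · exact (hp x).2.symm
    · exact (hq x).2.symm
  constructor
  · intro h S ⟨s, hs⟩ hSp hSq x
    obtain ⟨W⟩ := h.preconnected s x
    induction W with
    | nil => exact hs
    | cons hxy _ ih =>
      rcases (hadj _ _).1 hxy with rfl | rfl
      · exact ih (hSp _ hs)
      · exact ih (hSq _ hs)
  · intro h
    have : Nonempty (Fin n) := ⟨0⟩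
    refine ⟨fun x y => ?_⟩
    exact h {z | G.Reachable x z} ⟨x, SimpleGraph.Reachable.refl x⟩
      (fun z hz => hz.trans ((hadj _ _).2 (Or.inl rfl)).reachable)
      (fun z hz => hz.trans ((hadj _ _).2 (Or.inr rfl)).reachable) y

theorem JointlyTransitive.edgesOf_inter_eq_empty {p q : Fin n → Fin n} (hn : 2 < n)
    (hp : IsFPFInvolution p) (hq : IsFPFInvolution q) (h : JointlyTransitive p q) :
    edgesOf p ∩ edgesOf q = ∅ := by
  rw [Finset.eq_empty_iff_forall_notMem]
  intro e
  induction e with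
  | _ x y =>
    rw [Finset.mem_inter, mk_mem_edgesOf hp, mk_mem_edgesOf hq]
    rintro ⟨h1, h2⟩
    exact h.ne_of_two_lt_card hp hq (by simpa using hn) x (h2.symm.trans h1)

end Matching

/-- Let `k ≥ 2` and let `P` be a perfect matching of `K_{2k}`.  The number of perfect
matchings `Q` of `K_{2k}` sharing no edge with `P` such that the graph on the `2k` vertices
with edge set `P ∪ Q` is connected (a single `2k`-cycle) equals `(2k-2)!!`. -/
theorem card_hamiltonian_partners (k : ℕ) (hk : 2 ≤ k)
    (P : Finset (Sym2 (Fin (2 * k)))) (hP : IsPM P) :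
    Nat.card {Q : Finset (Sym2 (Fin (2 * k))) // IsPM Q ∧ P ∩ Q = ∅ ∧
        (SimpleGraph.fromEdgeSet (↑(P ∪ Q) : Set (Sym2 (Fin (2 * k))))).Connected} =
      Nat.doubleFactorial (2 * k - 2) := by
  have : NeZero (2 * k) := ⟨by omega⟩
  obtain ⟨p, hp, rfl⟩ := hP.exists_edgesOf_eq
  have hcard : Fintype.card (Fin (2 * k)) = 2 * (k - 1) + 2 := by
    rw [Fintype.card_fin]
    omega
  rw [show 2 * k - 2 = 2 * (k - 1) by omega, ← card_jointlyTransitive_involutions _ hp hcard]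
  symm
  refine Nat.card_congr (Equiv.ofBijective (fun q => ⟨edgesOf q.1, isPM_edgesOf q.2.1,
    q.2.2.edgesOf_inter_eq_empty (by omega) hp q.2.1,
    (connected_edgesOf_union_iff hp q.2.1).2 q.2.2⟩) ⟨?_, ?_⟩)
  · intro q r h
    exact Subtype.ext (edgesOf_inj q.2.1 r.2.1 (Subtype.mk.inj h))
  · rintro ⟨Q, hQ, _, hconn⟩
    obtain ⟨q, hq, rfl⟩ := hQ.exists_edgesOf_eq
    exact ⟨⟨q, hq, (connected_edgesOf_union_iff hp hq).1 hconn⟩, rfl⟩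
end
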